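/- arXiv:1208.6220 — 3 statements merged into one kernel-verified Lean document; each statement's English description precedes it below -/
import Mathlib

section
/- The only rational affine points on the curve y^2 = x^6 + x^4 - 1 are (x, y) = (±1, ±1). -/
namespace S14

/-- The properties of the ring of integers `ℤ[ρ]`, `ρ ^ 3 = ρ + 1`, used in the descent. -/
structure Good (O : Type*) [CommRing O] (ρ : O) : Prop where
  cube : ρ ^ 3 = ρ + 1
  two : Prime (2 : O)
  p23 : Prime (ρ - 3)
  units : ∀ u : Oˣ, ∃ w : Oˣ, (u : O) = w ^ 2 ∨ (u : O) = -w ^ 2 ∨ (u : O) = ρ * w ^ 2 ∨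
    (u : O) = -(ρ * w ^ 2)
  real : ∃ σ : O →+* ℝ, Function.Injective σ

variable {O : Type*} [CommRing O] {ρ : O}

theorem Good.al (h : Good O ρ) : ρ * (ρ ^ 2 - 1) = 1 := by
  linear_combination h.cube

theorem Good.unit (h : Good O ρ) : IsUnit ρ := IsUnit.of_mul_eq_one _ h.al

theorem Good.nd (h : Good O ρ) {u : O} (hu : IsUnit u) : ¬ (2 : O) ∣ u := fun hd =>
  h.two.not_isUnit (isUnit_of_dvd_unit hd hu)

/-- squares mod 2 -/
theorem Good.sq2 (h : Good O ρ) {p q : O} (hd : (2 : O) ∣ p ^ 2 - q ^ 2) : (2 : O) ∣ p - q := by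
  apply h.two.dvd_of_dvd_pow (n := 2)
  obtain ⟨k, hk⟩ := hd
  exact ⟨k - q * (p - q), by linear_combination hk⟩

/-- key non-square lemma modulo 4 -/
theorem Good.nsq (h : Good O ρ) [IsDomain O] {c k e p q : O} (he : IsUnit e)
    (hc : c - k ^ 2 = 2 * e)
    (hp : ¬ (2 : O) ∣ p) (hd : (4 : O) ∣ c * p ^ 2 - q ^ 2) : False := by
  have h1 : (2 : O) ∣ q - k * p := by
    apply h.sq2
    obtain ⟨t, ht⟩ := hd
    exact ⟨e * p ^ 2 - 2 * t, by linear_combination (p ^ 2) * hc - ht⟩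
  obtain ⟨f, hf⟩ := h1
  obtain ⟨t, ht⟩ := hd
  have h2 : (2 : O) ∣ e * p ^ 2 := by
    refine ⟨t + k * p * f + f ^ 2, ?_⟩
    apply mul_left_cancel₀ h.two.ne_zero
    linear_combination ht - p ^ 2 * hc + (q + k * p + 2 * f) * hf
  rcases h.two.dvd_or_dvd h2 with h3 | h3
  · exact h.nd he h3
  · exact hp (h.two.dvd_of_dvd_pow h3)

theorem Good.nsq1 (h : Good O ρ) [IsDomain O] {p q : O}
    (hp : ¬ (2 : O) ∣ p) (hd : (4 : O) ∣ (-1) * p ^ 2 - q ^ 2) : False :=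
  h.nsq (c := -1) (k := 1) (e := -1) (by simp) (by ring) hp hd

theorem Good.nsq2 (h : Good O ρ) [IsDomain O] {p q : O}
    (hp : ¬ (2 : O) ∣ p) (hd : (4 : O) ∣ ρ * p ^ 2 - q ^ 2) : False :=
  h.nsq (c := ρ) (k := ρ ^ 4) (e := -ρ ^ 5) ((h.unit.pow 5).neg)
    (by linear_combination (2 * ρ ^ 2 - ρ ^ 5 - ρ ^ 3 - ρ ^ 2 - ρ) * h.cube) hp hd

theorem Good.nsq3 (h : Good O ρ) [IsDomain O] {p q : O}
    (hp : ¬ (2 : O) ∣ p) (hd : (4 : O) ∣ (-ρ) * p ^ 2 - q ^ 2) : False :=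
  h.nsq (c := -ρ) (k := ρ ^ 4) (e := -ρ ^ 6) ((h.unit.pow 6).neg)
    (by linear_combination (2 * ρ ^ 3 - ρ ^ 5 - ρ ^ 3 - ρ ^ 2 + ρ) * h.cube) hp hd

/-- a unit that is a square modulo 4 is a square -/
theorem Good.usq (h : Good O ρ) [IsDomain O] {u : Oˣ} {p q : O}
    (hp : ¬ (2 : O) ∣ p) (hd : (4 : O) ∣ u * p ^ 2 - q ^ 2) : ∃ w : Oˣ, (u : O) = w ^ 2 := by
  obtain ⟨w, hw⟩ := h.units u
  have hwp : ¬ (2 : O) ∣ w * p := fun hd => by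
    rcases h.two.dvd_or_dvd hd with h3 | h3
    · exact h.nd w.isUnit h3
    · exact hp h3
  rcases hw with hw | hw | hw | hw
  · exact ⟨w, hw⟩
  · exact (h.nsq1 hwp (q := q) (by rw [hw] at hd; convert hd using 1; ring)).elim
  · exact (h.nsq2 hwp (q := q) (by rw [hw] at hd; convert hd using 1; ring)).elim
  · exact (h.nsq3 hwp (q := q) (by rw [hw] at hd; convert hd using 1; ring)).elim

theorem split [IsDomain O] [IsPrincipalIdealRing O] {A B z : O} (e : Oˣ) (hc : IsCoprime A B)
    (hz : z ≠ 0) (h : A * B = e * z ^ 2) :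
    ∃ (c : Oˣ) (p q : O), A = c * p ^ 2 ∧ z = p * q ∧ B * c = e * q ^ 2 ∧ IsCoprime p q := by
  have h1 : Associated (z ^ 2) (A * B) := ⟨e, by rw [h]; ring⟩
  obtain ⟨p, c, hp⟩ := exists_associated_pow_of_associated_pow_mul hc h1
  have hA : A = c * p ^ 2 := by rw [← hp]; ring
  have hp0 : p ≠ 0 := by
    rintro rfl
    have : (e : O) * z ^ 2 = 0 := by rw [← h, hA]; ring
    simp [hz] at this
  have hpz : p ∣ z := by
    rw [← IsIntegrallyClosed.pow_dvd_pow_iff (n := 2) two_ne_zero]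
    refine ⟨(e⁻¹ : Oˣ) * (c * B), ?_⟩
    have : ((e⁻¹ : Oˣ) : O) * e = 1 := by simp
    rw [hA] at h
    linear_combination (-z ^ 2) * this - ((e⁻¹ : Oˣ) : O) * h
  obtain ⟨q, hq⟩ := hpz
  have hB : B * c = e * q ^ 2 := by
    apply mul_left_cancel₀ (pow_ne_zero 2 hp0)
    rw [hA, hq] at h
    linear_combination h
  refine ⟨c, p, q, hA, hq, hB, ?_⟩
  have h3 : IsCoprime (p ^ 2) (q ^ 2) := by
    apply hc.of_isCoprime_of_dvd_left ⟨c, by rw [hA]; ring⟩ |>.of_isCoprime_of_dvd_right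
    refine ⟨(c⁻¹ : Oˣ) * e, ?_⟩
    have : ((c⁻¹ : Oˣ) : O) * c = 1 := by simp
    linear_combination (-B) * this + ((c⁻¹ : Oˣ) : O) * hB
  exact (IsCoprime.pow_iff two_pos two_pos).1 h3

/-- Factorisation step shared by both descents. -/
theorem half0 [IsDomain O] [IsPrincipalIdealRing O] {a b A B z M : O}
    (hD : Prime (a ^ 2 - 4 * b)) (hz : z ≠ 0) (hM : M = B - A - 2 * a * z ^ 2)
    (hc : IsCoprime M z) (hAB : A * B = - (a ^ 2 - 4 * b) * z ^ 4) :
    ∃ (c : Oˣ) (p q : O), z ^ 2 = p * q ∧ IsCoprime p q ∧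
      c * M = (c * p - a * q) ^ 2 - 4 * b * q ^ 2 := by
  have hcop : IsCoprime A B := by
    apply isCoprime_of_prime_dvd
    · rintro ⟨rfl, rfl⟩
      have : (a ^ 2 - 4 * b) * z ^ 4 = 0 := by linear_combination hAB
      rcases mul_eq_zero.1 this with h3 | h3
      · exact hD.ne_zero h3
      · exact hz (pow_eq_zero_iff (by norm_num) |>.1 h3)
    · intro π hπ hπA hπB
      have hπz : ¬ π ∣ z := by
        intro hπz
        have : π ∣ M := by
          have : M = B - A - 2 * a * z * z := by rw [hM]; ring
          rw [this]
          exact dvd_sub (dvd_sub hπB hπA) (hπz.mul_left _)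
        exact hπ.not_isUnit (hc.isUnit_of_dvd' this hπz)
      have h2 : π ^ 2 ∣ (a ^ 2 - 4 * b) * z ^ 4 := by
        have := mul_dvd_mul hπA hπB
        rw [hAB] at this
        rw [pow_two, ← dvd_neg]
        convert this using 1; ring
      have h3 : π ^ 2 ∣ (a ^ 2 - 4 * b) := by
        have : IsCoprime (π ^ 2) (z ^ 4) :=
          IsCoprime.pow ((hπ.irreducible.coprime_iff_not_dvd).2 hπz)
        exact this.dvd_of_dvd_mul_right h2
      obtain ⟨k, hk⟩ := h3
      have := hD.irreducible.isUnit_or_isUnit (a := π) (b := π * k) (by rw [hk]; ring)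
      rcases this with h4 | h4
      · exact hπ.not_isUnit h4
      · exact hπ.not_isUnit (isUnit_of_mul_isUnit_left h4)
  have hz2 : z ^ 2 ≠ 0 := pow_ne_zero 2 hz
  have hDAB : (a ^ 2 - 4 * b) ∣ A * B := ⟨-z ^ 4, by rw [hAB]; ring⟩
  rcases hD.dvd_or_dvd hDAB with ⟨A1, hA1⟩ | ⟨B1, hB1⟩
  · have h5 : B * A1 = (-1 : Oˣ) * (z ^ 2) ^ 2 := by
      apply mul_left_cancel₀ hD.ne_zero
      push_cast
      linear_combination hAB - B * hA1
    obtain ⟨c, p, q, hBc, hzpq, hA1c, hcpq⟩ := split (-1)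
      (hcop.symm.of_isCoprime_of_dvd_right ⟨a ^ 2 - 4 * b, by rw [hA1]; ring⟩) hz2 h5
    refine ⟨c, p, q, hzpq, hcpq, ?_⟩
    push_cast at hA1c
    rw [hM, hA1, hBc, hzpq]
    linear_combination -(a ^ 2 - 4 * b) * hA1c
  · have h5 : A * B1 = (-1 : Oˣ) * (z ^ 2) ^ 2 := by
      apply mul_left_cancel₀ hD.ne_zero
      push_cast
      linear_combination hAB - A * hB1
    obtain ⟨c, p, q, hBc, hzpq, hA1c, hcpq⟩ := split (-1)
      (hcop.of_isCoprime_of_dvd_right ⟨a ^ 2 - 4 * b, by rw [hB1]; ring⟩) hz2 h5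
    refine ⟨-c, p, q, hzpq, hcpq, ?_⟩
    push_cast at hA1c ⊢
    rw [hM, hB1, hBc, hzpq]
    linear_combination -(a ^ 2 - 4 * b) * hA1c

/-- The first half of a two-descent. -/
theorem half1 (h : Good O ρ) [IsDomain O] [IsPrincipalIdealRing O] {a b X z W : O}
    (hD : Prime (a ^ 2 - 4 * b))
    (hz : z ≠ 0) (hc : IsCoprime X z) (hX : ¬ (2 : O) ∣ X)
    (hW : W ^ 2 = X ^ 4 + a * X ^ 2 * (2 * z) ^ 2 + b * (2 * z) ^ 4) :
    ∃ P Q : O, P * Q = z ^ 2 ∧ IsCoprime P Q ∧ X ^ 2 = (P - a * Q) ^ 2 - 4 * b * Q ^ 2 := by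
  have h1 : (2 : O) ∣ W - X ^ 2 := by
    apply h.sq2
    exact ⟨2 * (a * X ^ 2 * z ^ 2 + 4 * b * z ^ 4), by linear_combination hW⟩
  obtain ⟨A0, hA0⟩ := h1
  obtain ⟨A, hA⟩ : ∃ A, A = A0 - a * z ^ 2 := ⟨_, rfl⟩
  obtain ⟨B, hB⟩ : ∃ B, B = A + X ^ 2 + 2 * a * z ^ 2 := ⟨_, rfl⟩
  have hWA : W = X ^ 2 + 2 * a * z ^ 2 + 2 * A := by rw [hA]; linear_combination hA0
  have hAB : A * B = - (a ^ 2 - 4 * b) * z ^ 4 := by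
    apply mul_left_cancel₀ h.two.ne_zero
    apply mul_left_cancel₀ h.two.ne_zero
    rw [hWA] at hW
    rw [hB]
    linear_combination hW
  obtain ⟨c, p, q, hpq, hcpq, heq⟩ := half0 (M := X ^ 2) hD hz (by rw [hB]; ring) hc.pow_left hAB
  obtain ⟨w, hw⟩ := h.usq (u := c) (q := c * p - a * q) hX
    ⟨-b * q ^ 2, by linear_combination heq⟩
  have hwi : ((w⁻¹ : Oˣ) : O) * w = 1 := by simp
  refine ⟨w * p, (w⁻¹ : Oˣ) * q, ?_, ?_, ?_⟩
  · rw [hpq]; linear_combination p * q * hwi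
  · exact (isCoprime_mul_unit_left_left w.isUnit _ _).2
      ((isCoprime_mul_unit_left_right (w⁻¹).isUnit _ _).2 hcpq)
  · apply mul_left_cancel₀ (pow_ne_zero 2 w.ne_zero)
    rw [hw] at heq
    rw [heq]
    have e1 : (w : O) ^ 2 * p - a * q = w * (w * p - a * ((w⁻¹ : Oˣ) * q)) := by
      linear_combination a * q * hwi
    have e2 : q = w * ((w⁻¹ : Oˣ) * q) := by linear_combination -q * hwi
    rw [e1]
    linear_combination (-4 * b * (q + w * ((w⁻¹ : Oˣ) * q))) * e2

/-- The full descent step. -/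
theorem desc (h : Good O ρ) [IsDomain O] [IsPrincipalIdealRing O] {a b β X Z W : O}
    (hb : b = ρ * β ^ 2) (hβ : IsUnit β)
    (hD : Prime (a ^ 2 - 4 * b)) (hneg : ∀ σ : O →+* ℝ, σ (a ^ 2 - 4 * b) < 0)
    (hc : IsCoprime X Z) (hX : ¬ (2 : O) ∣ X) (hZ : (2 : O) ∣ Z)
    (hW : W ^ 2 = X ^ 4 + a * X ^ 2 * Z ^ 2 + b * Z ^ 4) :
    ∃ r s V : O, IsCoprime r s ∧ V ^ 2 = r ^ 4 + a * r ^ 2 * s ^ 2 + b * s ^ 4 ∧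
      Z * (r ^ 4 - b * s ^ 4) = 2 * X * r * s * V := by
  by_cases hZ0 : Z = 0
  · exact ⟨1, 0, 1, isCoprime_one_left, by ring, by rw [hZ0]; ring⟩
  obtain ⟨z, rfl⟩ := hZ
  have hz : z ≠ 0 := by rintro rfl; simp at hZ0
  have hcz : IsCoprime X z := hc.of_isCoprime_of_dvd_right ⟨2, by ring⟩
  obtain ⟨P, Q, hPQ, hcPQ, hXPQ⟩ := half1 h hD hz hcz hX hW
  have hQ0 : Q ≠ 0 := by
    rintro rfl
    exact hz (pow_eq_zero_iff two_ne_zero |>.1 (by rw [← hPQ]; ring))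
  have h1 : (2 : O) ∣ (P - a * Q) - X := by
    apply h.sq2
    exact ⟨2 * b * Q ^ 2, by linear_combination -hXPQ⟩
  obtain ⟨j, hj⟩ := h1
  have hbu : IsUnit b := by rw [hb]; exact h.unit.mul (hβ.pow 2)
  obtain ⟨bu, hbu'⟩ := hbu
  have hjj : j * (j + X) = bu * Q ^ 2 := by
    apply mul_left_cancel₀ h.two.ne_zero
    apply mul_left_cancel₀ h.two.ne_zero
    have : P - a * Q = X + 2 * j := by linear_combination hj
    rw [this] at hXPQ
    rw [hbu']
    linear_combination -hXPQ
  have hcj : IsCoprime j (j + X) := by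
    apply isCoprime_of_prime_dvd
    · rintro ⟨rfl, h0⟩
      rw [zero_mul] at hjj
      have := mul_eq_zero.1 hjj.symm
      simp [hQ0] at this
    · intro π hπ h2 h3
      have h4 : π ∣ Q ^ 2 := by
        have : π ∣ bu * Q ^ 2 := by rw [← hjj]; exact h2.mul_right _
        exact (Units.dvd_mul_left).1 this
      have h5 : π ∣ z := by
        apply hπ.dvd_of_dvd_pow (n := 2)
        rw [← hPQ]
        exact (hπ.dvd_of_dvd_pow h4).mul_left _
      have h6 : π ∣ X := (dvd_add_right h2).1 h3
      exact hπ.not_isUnit (hcz.isUnit_of_dvd' h6 h5)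
  obtain ⟨g, r, s, hjr, hQrs, hjs, hcrs⟩ := split bu hcj hQ0 hjj
  obtain ⟨e3, V1, m, hP, hzm, hQm, -⟩ := split 1 hcPQ hz (by rw [hPQ]; simp)
  have hm0 : m ≠ 0 := by rintro rfl; simp at hzm; exact hz hzm
  have e3i : ((e3⁻¹ : Oˣ) : O) * e3 = 1 := by simp
  rw [Units.val_one, one_mul] at hQm
  obtain ⟨e1, r1, s1, hr, hm, hs, hcr⟩ := split e3⁻¹ hcrs hm0 (by
    rw [← hQrs]; linear_combination -Q * e3i + ((e3⁻¹ : Oˣ) : O) * hQm)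
  have hs' : s * e1 * e3 = s1 ^ 2 := by linear_combination e3 * hs + s1 ^ 2 * e3i
  have hs10 : s1 ≠ 0 := by rintro rfl; simp at hm; exact hm0 hm
  -- relations
  obtain ⟨k, hk⟩ : ∃ k : Oˣ, k = g * e1 ^ 2 * e3 := ⟨_, rfl⟩
  have hk' : (k : O) = g * e1 ^ 2 * e3 := by rw [hk]; push_cast; ring
  have hgP : g * P = g ^ 2 * r ^ 2 + a * g * r * s + b * s ^ 2 := by
    rw [← hbu']
    linear_combination g * hj + a * g * hQrs + hjs + g * hjr
  have hgX : g * X = b * s ^ 2 - g ^ 2 * r ^ 2 := by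
    rw [← hbu']; linear_combination hjs - g * hjr
  obtain ⟨V, hV⟩ : ∃ V, V = e3 * V1 := ⟨_, rfl⟩
  have R1 : k * V ^ 2 = k ^ 2 * r1 ^ 4 + a * k * r1 ^ 2 * s1 ^ 2 + b * s1 ^ 4 := by
    rw [hP, hr] at hgP
    rw [hk', hV, show s1 ^ 4 = (s1 ^ 2) ^ 2 by ring, ← hs']
    linear_combination e1 ^ 2 * e3 ^ 2 * hgP
  have R2 : k * e3 * X = b * s1 ^ 4 - k ^ 2 * r1 ^ 4 := by
    rw [hr] at hgX
    rw [hk', show s1 ^ 4 = (s1 ^ 2) ^ 2 by ring, ← hs']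
    linear_combination e1 ^ 2 * e3 ^ 2 * hgX
  have R3 : e3 * z = V * r1 * s1 := by rw [hzm, hm, hV]; ring
  obtain ⟨σ, hσ⟩ := h.real
  have hkp : 0 < σ k := by
    have h1 := congrArg σ R1
    have h2 := hneg σ
    have h3 : σ s1 ≠ 0 := by
      rwa [Ne, map_eq_zero_iff σ hσ]
    simp only [map_mul, map_pow, map_add, map_sub, map_ofNat] at h1 h2
    have h4 : 0 < σ s1 ^ 4 := by positivity
    have h5 : 0 < σ k * σ V ^ 2 := by
      nlinarith [sq_nonneg (2 * σ k * σ r1 ^ 2 + σ a * σ s1 ^ 2), mul_pos (neg_pos.2 h2) h4]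
    exact pos_of_mul_pos_left h5 (by positivity)
  have hρ : 0 < σ ρ := by
    have := congrArg σ h.cube
    simp only [map_pow, map_add, map_one] at this
    by_contra hn
    nlinarith [sq_nonneg (σ ρ), sq_nonneg (σ ρ + 1)]
  obtain ⟨w, hw | hw | hw | hw⟩ := h.units k
  · refine ⟨w * r1, s1, -(w * V), (isCoprime_mul_unit_left_left w.isUnit _ _).2 hcr, ?_, ?_⟩
    · rw [hw] at R1; linear_combination R1
    · rw [hw] at R2
      linear_combination (2 * z) * R2 - 2 * w ^ 2 * X * R3
  · rw [hw] at hkp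
    simp only [map_neg, map_pow] at hkp
    nlinarith [sq_nonneg (σ w)]
  · have hρ0 : ρ ≠ 0 := h.unit.ne_zero
    refine ⟨β * s1, w * r1, β * w * V, ?_, ?_, ?_⟩
    · exact (isCoprime_mul_unit_left_left hβ _ _).2
        ((isCoprime_mul_unit_left_right w.isUnit _ _).2 hcr.symm)
    · rw [hw, hb] at R1
      rw [hb]
      apply mul_left_cancel₀ hρ0
      linear_combination β ^ 2 * R1
    · rw [hw, hb] at R2
      rw [hb]
      apply mul_left_cancel₀ hρ0
      linear_combination (-2 * z * β ^ 2) * R2 + 2 * ρ * β ^ 2 * w ^ 2 * X * R3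
  · rw [hw] at hkp
    simp only [map_neg, map_pow, map_mul] at hkp
    nlinarith [mul_nonneg hρ.le (sq_nonneg (σ w))]

theorem Good.odd_mul (h : Good O ρ) {p q : O} (hp : ¬ (2 : O) ∣ p) (hq : ¬ (2 : O) ∣ q) :
    ¬ (2 : O) ∣ p * q := fun hd => (h.two.dvd_or_dvd hd).elim hp hq

theorem Good.odd_pow (h : Good O ρ) {p : O} (hp : ¬ (2 : O) ∣ p) (n : ℕ) :
    ¬ (2 : O) ∣ p ^ n := fun hd => hp (h.two.dvd_of_dvd_pow hd)

/-- First descent on solutions with both coordinates odd. -/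
theorem bothodd (h : Good O ρ) [IsDomain O] [IsPrincipalIdealRing O] {a b X Z W : O}
    (hD : Prime (a ^ 2 - 4 * b))
    (hc : IsCoprime X Z) (hZ : ¬ (2 : O) ∣ Z)
    (hW : W ^ 2 = X ^ 4 + a * X ^ 2 * Z ^ 2 + b * Z ^ 4) :
    ∃ (c n m t : O) (w : Oˣ), (c = 1 ∨ c = -1 ∨ c = ρ ∨ c = -ρ) ∧ ¬ (2 : O) ∣ m ∧
      n * m = w * Z ∧ 2 * t = c * n ^ 2 - a * m ^ 2 ∧ c * (w * X) ^ 2 = t ^ 2 - b * m ^ 4 := by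
  have hZ0 : Z ≠ 0 := by rintro rfl; exact hZ (dvd_zero _)
  have hcop : IsCoprime (4 * X ^ 2) Z := by
    apply IsCoprime.mul_left
    · have : IsCoprime (2 : O) Z := (h.two.irreducible.coprime_iff_not_dvd).2 hZ
      have h2 := this.pow_left (m := 2)
      convert h2 using 1; norm_num
    · exact hc.pow_left
  obtain ⟨c, p, q, hpq, hcpq, heq⟩ := half0 (A := 2 * W - 2 * X ^ 2 - a * Z ^ 2)
    (B := 2 * W + 2 * X ^ 2 + a * Z ^ 2) (M := 4 * X ^ 2) hD hZ0 (by ring) hcop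
    (by linear_combination 4 * hW)
  obtain ⟨e, n, m, hp, hZnm, hqe, -⟩ := split 1 hcpq hZ0 (by rw [← hpq]; simp)
  rw [Units.val_one, one_mul] at hqe
  obtain ⟨w, hw⟩ := h.units (c * e ^ 2)
  have key : ∀ c0 : O, (c * e ^ 2 : O) = c0 * w ^ 2 →
      2 * (2 * (c0 * (w * X) ^ 2)) = (c0 * (w * n) ^ 2 - a * m ^ 2) ^ 2 - 2 * (2 * (b * m ^ 4)) := by
    intro c0 hc0
    have e1 : c0 * (w * n) ^ 2 - a * m ^ 2 = e * (c * p - a * q) := by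
      rw [hp]; linear_combination (-n ^ 2) * hc0 + a * hqe
    rw [e1]
    linear_combination (-4 * X ^ 2) * hc0 + e ^ 2 * heq - 4 * b * (q * e + m ^ 2) * hqe
  have hm : ¬ (2 : O) ∣ m := fun hd => hZ (by rw [hZnm]; exact hd.mul_left _)
  have fin : ∀ c0 : O, (c * e ^ 2 : O) = c0 * w ^ 2 →
      (c0 = 1 ∨ c0 = -1 ∨ c0 = ρ ∨ c0 = -ρ) →
      ∃ (c n m t : O) (w : Oˣ), (c = 1 ∨ c = -1 ∨ c = ρ ∨ c = -ρ) ∧ ¬ (2 : O) ∣ m ∧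
      n * m = w * Z ∧ 2 * t = c * n ^ 2 - a * m ^ 2 ∧ c * (w * X) ^ 2 = t ^ 2 - b * m ^ 4 := by
    intro c0 hc0 hcc
    have k := key c0 hc0
    have : (2 : O) ∣ (c0 * (w * n) ^ 2 - a * m ^ 2) := by
      apply h.two.dvd_of_dvd_pow (n := 2)
      exact ⟨2 * (c0 * (w * X) ^ 2) + 2 * (b * m ^ 4), by linear_combination -k⟩
    obtain ⟨t, ht⟩ := this
    refine ⟨c0, w * n, m, t, w, hcc, hm, by rw [hZnm]; ring, ht.symm, ?_⟩
    apply mul_left_cancel₀ h.two.ne_zero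
    apply mul_left_cancel₀ h.two.ne_zero
    rw [ht] at k
    linear_combination k
  push_cast at hw
  rcases hw with hw | hw | hw | hw
  · exact fin 1 (by rw [hw]; ring) (by simp)
  · exact fin (-1) (by rw [hw]; ring) (by simp)
  · exact fin ρ (by rw [hw]) (by simp)
  · exact fin (-ρ) (by rw [hw]; ring) (by simp)

theorem bosub (h : Good O ρ) [IsDomain O] {a b c n m t x n0 t0 R E : O} (hc : IsUnit c)
    (hn : c * n0 ^ 2 - a = 2 * t0) (hE : t0 ^ 2 - b = R + 4 * E)
    (ht : 2 * t = c * n ^ 2 - a * m ^ 2) (hx : c * x ^ 2 = t ^ 2 - b * m ^ 4) :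
    (2 : O) ∣ n - n0 * m ∧ (4 : O) ∣ c * x ^ 2 - R * m ^ 4 := by
  have h1 : (2 : O) ∣ n - n0 * m := by
    apply h.sq2
    have : (2 : O) ∣ c * (n ^ 2 - (n0 * m) ^ 2) :=
      ⟨t - t0 * m ^ 2, by linear_combination (-m ^ 2) * hn - ht⟩
    exact (h.two.dvd_or_dvd this).resolve_left (h.nd hc)
  refine ⟨h1, ?_⟩
  obtain ⟨f, hf⟩ := h1
  have hn' : n = n0 * m + 2 * f := by linear_combination hf
  have ht' : t = t0 * m ^ 2 + 2 * (c * f * (n0 * m + f)) := by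
    apply mul_left_cancel₀ h.two.ne_zero
    rw [ht, hn']; linear_combination m ^ 2 * hn
  refine ⟨E * m ^ 4 + t0 * m ^ 2 * (c * f * (n0 * m + f)) + (c * f * (n0 * m + f)) ^ 2, ?_⟩
  rw [hx, ht']
  linear_combination m ^ 4 * hE

/-- No solutions with both coordinates odd on the first curve. -/
theorem bo1 (h : Good O ρ) [IsDomain O] [IsPrincipalIdealRing O] {X Z W : O}
    (hD : Prime ((ρ ^ 2) ^ 2 - 4 * ρ))
    (hc : IsCoprime X Z) (hX : ¬ (2 : O) ∣ X) (hZ : ¬ (2 : O) ∣ Z)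
    (hW : W ^ 2 = X ^ 4 + ρ ^ 2 * X ^ 2 * Z ^ 2 + ρ * Z ^ 4) : False := by
  obtain ⟨c, n, m, t, w, hcc, hm, -, ht, hx⟩ := bothodd h hD hc hZ hW
  have hwX : ¬ (2 : O) ∣ w * X := h.odd_mul (h.nd w.isUnit) hX
  have hm2 := h.odd_pow hm 2
  rcases hcc with hc0 | hc0 | hc0 | hc0 <;> rw [hc0] at ht hx
  · obtain ⟨-, k, hk⟩ := bosub h (n0 := ρ) (t0 := 0) (R := -ρ) (E := 0) isUnit_one
      (by ring) (by ring) ht hx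
    exact h.nsq3 hm2 (q := w * X) ⟨-k, by linear_combination -hk⟩
  · obtain ⟨-, k, hk⟩ := bosub h (n0 := ρ) (t0 := -ρ ^ 2) (R := ρ ^ 2) (E := 0) isUnit_one.neg
      (by ring) (by linear_combination ρ * h.cube) ht hx
    exact h.nsq1 hwX (q := ρ * m ^ 2) ⟨k, by linear_combination hk⟩
  · obtain ⟨-, k, hk⟩ := bosub h (n0 := ρ ^ 2 + ρ) (t0 := ρ ^ 2 + 2 * ρ + 1) (R := -(ρ ^ 2 - 1))
      (E := 2 * ρ ^ 2 + 2 * ρ + 1) h.unit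
      (by linear_combination (2 + 2 * ρ + ρ ^ 2) * h.cube)
      (by linear_combination (4 + ρ) * h.cube) ht hx
    exact h.nsq1 hm2 (q := ρ * (w * X)) ⟨-ρ * k, by
      linear_combination (-ρ) * hk + m ^ 4 * h.al⟩
  · obtain ⟨-, k, hk⟩ := bosub h (n0 := ρ ^ 2 + ρ) (t0 := -(2 * ρ ^ 2 + 2 * ρ + 1))
      (R := -(ρ ^ 2 - 1) ^ 4)
      (E := 3 * ρ ^ 2 + 4 * ρ + 2) h.unit.neg
      (by linear_combination (-2 - 2 * ρ - ρ ^ 2) * h.cube)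
      (by linear_combination (6 + 7 * ρ + ρ ^ 2 - 3 * ρ ^ 3 + ρ ^ 5) * h.cube) ht hx
    exact h.nsq2 hwX (q := (ρ ^ 2 - 1) ^ 2 * m ^ 2) ⟨-k, by linear_combination -hk⟩

/-- Solutions with both coordinates odd on the second curve. -/
theorem bo2 (h : Good O ρ) [IsDomain O] [IsPrincipalIdealRing O] {X Z W : O}
    (hD : Prime (ρ ^ 2 - 4 * (ρ ^ 2 - 1)))
    (hc : IsCoprime X Z) (hX : ¬ (2 : O) ∣ X) (hZ : ¬ (2 : O) ∣ Z)
    (hW : W ^ 2 = X ^ 4 + ρ * X ^ 2 * Z ^ 2 + (ρ ^ 2 - 1) * Z ^ 4) : (2 : O) ∣ X - Z := by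
  obtain ⟨c, n, m, t, w, hcc, hm, hnm, ht, hx⟩ := bothodd h hD hc hZ hW
  have hwX : ¬ (2 : O) ∣ w * X := h.odd_mul (h.nd w.isUnit) hX
  have hm2 := h.odd_pow hm 2
  have hal : IsUnit (ρ ^ 2 - 1) := IsUnit.of_mul_eq_one ρ (by rw [mul_comm]; exact h.al)
  rcases hcc with hc0 | hc0 | hc0 | hc0 <;> rw [hc0] at ht hx
  · exfalso
    obtain ⟨-, k, hk⟩ := bosub h (n0 := ρ ^ 2 + ρ) (t0 := ρ ^ 2 + ρ + 1)
      (R := -(ρ ^ 2 - 1) ^ 3) (E := ρ ^ 2 + ρ + 1) isUnit_one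
      (by linear_combination (2 + ρ) * h.cube)
      (by linear_combination (3 - ρ + ρ ^ 3) * h.cube) ht hx
    exact h.nsq3 (h.odd_mul (h.odd_pow (h.nd hal) 2) hm2) (q := w * X) ⟨-k, by
      linear_combination -hk - (ρ ^ 2 - 1) ^ 3 * m ^ 4 * h.al⟩
  · obtain ⟨⟨f, hf⟩, k, hk⟩ := bosub h (n0 := ρ ^ 2 + ρ) (t0 := -(ρ ^ 2 + 2 * ρ + 1))
      (R := (ρ ^ 2 + 2 * ρ + 1) ^ 2 - (ρ ^ 2 - 1)) (E := 0) isUnit_one.neg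
      (by linear_combination (-2 - ρ) * h.cube) (by ring) ht hx
    have h2 : (2 : O) ∣ w * X - (ρ ^ 2 + ρ) * m ^ 2 := by
      apply h.sq2
      exact ⟨-2 * k - (4 * ρ ^ 2 + 6 * ρ + 4) * m ^ 4,
        by linear_combination -hk - m ^ 4 * (2 * ρ + 6) * h.cube⟩
    have h3 : (2 : O) ∣ w * (X - Z) := by
      obtain ⟨g, hg⟩ := h2
      exact ⟨g - f * m, by linear_combination hg - m * hf + hnm⟩
    exact (h.two.dvd_or_dvd h3).resolve_left (h.nd w.isUnit)
  · exfalso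
    obtain ⟨-, k, hk⟩ := bosub h (n0 := 1) (t0 := 0) (R := -(ρ ^ 2 - 1)) (E := 0) h.unit
      (by ring) (by ring) ht hx
    exact h.nsq1 hm2 (q := ρ * (w * X)) ⟨-ρ * k, by
      linear_combination (-ρ) * hk + m ^ 4 * h.al⟩
  · exfalso
    obtain ⟨-, k, hk⟩ := bosub h (n0 := 1) (t0 := -ρ) (R := 1) (E := 0) h.unit.neg
      (by ring) (by ring) ht hx
    exact h.nsq3 hwX (q := m ^ 2) ⟨k, by linear_combination hk⟩

theorem cubic_real {t : ℝ} (ht : t ^ 3 = t + 1) : 0 < t ∧ t < 3 := by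
  have h0 : 0 < t := by
    by_contra hn
    push Not at hn
    rcases le_or_gt t (-1) with h1 | h1
    · nlinarith [mul_nonneg (sub_nonneg.2 h1) (sq_nonneg t), sq_nonneg (t - 1), sq_nonneg (t + 1)]
    · nlinarith [mul_nonneg (neg_nonneg.2 hn) (sq_nonneg t)]
  refine ⟨h0, ?_⟩
  by_contra hn
  push Not at hn
  nlinarith [mul_nonneg (sub_nonneg.2 hn) (sq_nonneg t), mul_nonneg (sub_nonneg.2 hn) h0.le]

theorem Good.hD1 (h : Good O ρ) : Prime ((ρ ^ 2) ^ 2 - 4 * ρ) := by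
  obtain ⟨u, hu⟩ := h.unit
  have : Associated (ρ - 3) ((ρ ^ 2) ^ 2 - 4 * ρ) :=
    ⟨u, by rw [hu]; linear_combination (-ρ) * h.cube⟩
  exact this.prime h.p23

theorem Good.unit' (h : Good O ρ) : IsUnit (ρ ^ 2 - 1) :=
  IsUnit.of_mul_eq_one ρ (by rw [mul_comm]; exact h.al)

theorem Good.hD2 (h : Good O ρ) : Prime (ρ ^ 2 - 4 * (ρ ^ 2 - 1)) := by
  obtain ⟨u, hu⟩ := h.unit'
  have : Associated (ρ - 3) (ρ ^ 2 - 4 * (ρ ^ 2 - 1)) :=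
    ⟨u, by rw [hu]; linear_combination h.cube⟩
  exact this.prime h.p23

theorem Good.neg1 (h : Good O ρ) (σ : O →+* ℝ) : σ ((ρ ^ 2) ^ 2 - 4 * ρ) < 0 := by
  have h1 : (σ ρ) ^ 3 = σ ρ + 1 := by rw [← map_pow, h.cube]; simp
  obtain ⟨h2, h3⟩ := cubic_real h1
  have : σ ((ρ ^ 2) ^ 2 - 4 * ρ) = σ ρ * (σ ρ - 3) := by
    simp only [map_sub, map_mul, map_pow, map_ofNat]
    linear_combination σ ρ * h1
  rw [this]
  exact mul_neg_of_pos_of_neg h2 (by linarith)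

theorem Good.neg2 (h : Good O ρ) (σ : O →+* ℝ) : σ (ρ ^ 2 - 4 * (ρ ^ 2 - 1)) < 0 := by
  have h1 : (σ ρ) ^ 3 = σ ρ + 1 := by rw [← map_pow, h.cube]; simp
  obtain ⟨h2, h3⟩ := cubic_real h1
  have : σ ρ * σ (ρ ^ 2 - 4 * (ρ ^ 2 - 1)) = (σ ρ - 3) := by
    simp only [map_sub, map_mul, map_pow, map_ofNat, map_one]
    linear_combination (-3) * h1
  by_contra hn
  push Not at hn
  have := mul_nonneg h2.le hn
  linarith

theorem Good.notboth (h : Good O ρ) {X Z : O} (hc : IsCoprime X Z) :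
    ¬ ((2 : O) ∣ X ∧ (2 : O) ∣ Z) := fun ⟨h1, h2⟩ =>
  h.two.not_isUnit (hc.isUnit_of_dvd' h1 h2)

theorem L1a (h : Good O ρ) [IsDomain O] [IsPrincipalIdealRing O] {X Z W : O}
    (hc : IsCoprime X Z) (hW : W ^ 2 = X ^ 4 + ρ ^ 2 * X ^ 2 * Z ^ 2 + ρ * Z ^ 4) :
    ¬ (2 : O) ∣ X ∧ (2 : O) ∣ Z := by
  have hX : ¬ (2 : O) ∣ X := by
    intro hX
    have hZ : ¬ (2 : O) ∣ Z := fun hZ => h.notboth hc ⟨hX, hZ⟩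
    obtain ⟨x, rfl⟩ := hX
    exact h.nsq2 (h.odd_pow hZ 2) (q := W) ⟨-(4 * x ^ 4 + ρ ^ 2 * x ^ 2 * Z ^ 2), by
      linear_combination -hW⟩
  refine ⟨hX, ?_⟩
  by_contra hZ
  exact bo1 h h.hD1 hc hX hZ hW

theorem L1b (h : Good O ρ) [IsDomain O] [IsPrincipalIdealRing O] (k : ℕ) : ∀ {X Z W : O},
    IsCoprime X Z → W ^ 2 = X ^ 4 + ρ ^ 2 * X ^ 2 * Z ^ 2 + ρ * Z ^ 4 → (2 : O) ^ k ∣ Z := by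
  induction k with
  | zero => intros; simp
  | succ k ih =>
    intro X Z W hc hW
    obtain ⟨hX, hZ⟩ := L1a h hc hW
    obtain ⟨r, s, V, hrs, hV, he⟩ := desc h (β := 1) (by ring) isUnit_one h.hD1 h.neg1 hc hX hZ hW
    obtain ⟨hr, hs⟩ := L1a h hrs hV
    have hs' := ih hrs hV
    have hodd : ¬ (2 : O) ∣ r ^ 4 - ρ * s ^ 4 := by
      intro hd
      apply h.odd_pow hr 4
      have := dvd_add hd ((dvd_pow hs (n := 4) (by norm_num)).mul_left ρ)
      simpa using this
    refine h.two.pow_dvd_of_dvd_mul_right _ hodd ?_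
    rw [he, pow_succ']
    obtain ⟨s', hs'⟩ := hs'
    exact ⟨X * r * s' * V, by rw [hs']; ring⟩

theorem Good.pow_dvd_zero (h : Good O ρ) [IsDomain O] [IsPrincipalIdealRing O] {Z : O}
    (hZ : ∀ k : ℕ, (2 : O) ^ k ∣ Z) : Z = 0 := by
  by_contra hn
  obtain ⟨n, hn⟩ := FiniteMultiplicity.of_prime_left h.two hn
  exact hn (hZ _)

theorem L1 (h : Good O ρ) [IsDomain O] [IsPrincipalIdealRing O] {X Z W : O}
    (hc : IsCoprime X Z) (hW : W ^ 2 = X ^ 4 + ρ ^ 2 * X ^ 2 * Z ^ 2 + ρ * Z ^ 4) : Z = 0 :=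
  h.pow_dvd_zero fun k => L1b h k hc hW

theorem L2a (h : Good O ρ) [IsDomain O] {X Z W : O}
    (hc : IsCoprime X Z) (hW : W ^ 2 = X ^ 4 + ρ * X ^ 2 * Z ^ 2 + (ρ ^ 2 - 1) * Z ^ 4) :
    ¬ (2 : O) ∣ X := by
  intro hX
  have hZ : ¬ (2 : O) ∣ Z := fun hZ => h.notboth hc ⟨hX, hZ⟩
  obtain ⟨x, rfl⟩ := hX
  exact h.nsq2 (h.odd_mul (h.nd h.unit') (h.odd_pow hZ 2)) (q := W)
    ⟨-(4 * x ^ 4 + ρ * x ^ 2 * Z ^ 2), by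
      linear_combination -hW + (ρ ^ 2 - 1) * Z ^ 4 * h.al⟩

theorem Vcong (h : Good O ρ) [IsDomain O] [IsPrincipalIdealRing O] {r s V : O}
    (hrs : IsCoprime r s) (hs : ¬ (2 : O) ∣ s)
    (hV : V ^ 2 = r ^ 4 + ρ * r ^ 2 * s ^ 2 + (ρ ^ 2 - 1) * s ^ 4) :
    (2 : O) ∣ r - s ∧ (2 : O) ∣ V - ρ ^ 2 * s ^ 2 := by
  have hr := L2a h hrs hV
  have h1 := bo2 h h.hD2 hrs hr hs hV
  refine ⟨h1, ?_⟩
  obtain ⟨f, hf⟩ := h1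
  obtain rfl : r = s + 2 * f := by linear_combination hf
  apply h.sq2
  exact ⟨4 * s ^ 3 * f + 12 * s ^ 2 * f ^ 2 + 16 * s * f ^ 3 + 8 * f ^ 4
    + ρ * s ^ 2 * (2 * s * f + 2 * f ^ 2), by linear_combination hV - ρ * s ^ 4 * h.cube⟩

theorem L2 (h : Good O ρ) [IsDomain O] [IsPrincipalIdealRing O] (j : ℕ) : ∀ {X Z W : O},
    IsCoprime X Z → W ^ 2 = X ^ 4 + ρ * X ^ 2 * Z ^ 2 + (ρ ^ 2 - 1) * Z ^ 4 →
    (2 : O) ^ (j + 1) ∣ Z → (2 : O) ^ (j + 2) ∣ Z - 2 ^ (j + 1) * X ∨ (2 : O) ^ (j + 2) ∣ Z := by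
  induction j with
  | zero =>
    intro X Z W hc hW hZ
    have hX := L2a h hc hW
    obtain ⟨r, s, V, hrs, hV, he⟩ := desc h (β := ρ ^ 2 - 1)
      (by linear_combination (-(ρ ^ 2 - 1)) * h.al) h.unit' h.hD2 h.neg2 hc hX
      (by simpa using hZ) hW
    have hr := L2a h hrs hV
    by_cases hs : (2 : O) ∣ s
    · right
      obtain ⟨s', rfl⟩ := hs
      have hodd : ¬ (2 : O) ∣ r ^ 4 - (ρ ^ 2 - 1) * (2 * s') ^ 4 := by
        rintro ⟨g, hg⟩
        exact h.odd_pow hr 4 ⟨g + (ρ ^ 2 - 1) * 8 * s' ^ 4, by linear_combination hg⟩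
      refine h.two.pow_dvd_of_dvd_mul_right _ hodd ?_
      rw [he]
      exact ⟨X * r * s' * V, by ring⟩
    · left
      obtain ⟨⟨f, hf⟩, hVV⟩ := Vcong h hrs hs hV
      obtain rfl : r = s + 2 * f := by linear_combination hf
      have hodd : ¬ (2 : O) ∣ (s + 2 * f) ^ 4 - (ρ ^ 2 - 1) * s ^ 4 := by
        rintro ⟨g, hg⟩
        refine h.odd_mul (h.nd (h.unit.pow 2)) (h.odd_pow hs 4) ⟨s ^ 4 + 4 * s ^ 3 * f
          + 12 * s ^ 2 * f ^ 2 + 16 * s * f ^ 3 + 8 * f ^ 4 - g, by linear_combination -hg⟩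
      refine h.two.pow_dvd_of_dvd_mul_right _ hodd ?_
      obtain ⟨g, hg⟩ := hVV
      obtain rfl : V = ρ ^ 2 * s ^ 2 + 2 * g := by linear_combination hg
      refine ⟨X * (ρ ^ 2 * s ^ 4 - s ^ 4 + (f * s * ρ ^ 2 * s ^ 2 + s ^ 2 * g + 2 * f * s * g)
        - (4 * s ^ 3 * f + 12 * s ^ 2 * f ^ 2 + 16 * s * f ^ 3 + 8 * f ^ 4)), ?_⟩
      linear_combination he
  | succ j ih =>
    intro X Z W hc hW hZ
    have hX := L2a h hc hW
    obtain ⟨r, s, V, hrs, hV, he⟩ := desc h (β := ρ ^ 2 - 1)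
      (by linear_combination (-(ρ ^ 2 - 1)) * h.al) h.unit' h.hD2 h.neg2 hc hX
      ((dvd_pow_self 2 (by omega)).trans hZ) hW
    have hr := L2a h hrs hV
    have hb := h.two.ne_zero
    obtain ⟨μ, hμ⟩ := hZ
    have he2 : X * r * s * V = 2 ^ (j + 1) * (μ * (r ^ 4 - (ρ ^ 2 - 1) * s ^ 4)) := by
      apply mul_left_cancel₀ hb
      rw [hμ] at he
      linear_combination -he
    have hs2 : (2 : O) ∣ s := by
      by_contra hs
      obtain ⟨-, g, hg⟩ := Vcong h hrs hs hV
      have hVo : ¬ (2 : O) ∣ V := by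
        rintro ⟨v, hv⟩
        exact h.odd_mul (h.nd (h.unit.pow 2)) (h.odd_pow hs 2) ⟨v - g, by
          linear_combination hv - hg⟩
      apply h.odd_mul (h.odd_mul (h.odd_mul hX hr) hs) hVo
      rw [he2]
      exact (dvd_pow_self 2 (by omega)).mul_right _
    obtain ⟨s', hs'⟩ := hs2
    have hVV : (2 : O) ∣ V - r ^ 2 := by
      apply h.sq2
      exact ⟨ρ * r ^ 2 * s * s' + (ρ ^ 2 - 1) * s ^ 3 * s', by
        linear_combination hV + (ρ * r ^ 2 * s + (ρ ^ 2 - 1) * s ^ 3) * hs'⟩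
    obtain ⟨g, hg⟩ := hVV
    have hVo : ¬ (2 : O) ∣ V := by
      rintro ⟨v, hv⟩
      exact h.odd_pow hr 2 ⟨v - g, by linear_combination hv - hg⟩
    have hs : (2 : O) ^ (j + 1) ∣ s := by
      refine h.two.pow_dvd_of_dvd_mul_left _ (h.odd_mul (h.odd_mul hX hr) hVo) ?_
      exact ⟨_, by rw [← he2]; ring⟩
    have hodd : ¬ (2 : O) ∣ r ^ 4 - (ρ ^ 2 - 1) * s ^ 4 := by
      rintro ⟨q, hq⟩
      exact h.odd_pow hr 4 ⟨q + (ρ ^ 2 - 1) * s' * s ^ 3, by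
        linear_combination hq + (ρ ^ 2 - 1) * s ^ 3 * hs'⟩
    rcases ih hrs hV hs with ⟨e, hse⟩ | ⟨e, hse⟩
    · left
      refine h.two.pow_dvd_of_dvd_mul_right _ hodd ?_
      refine ⟨X * (r ^ 2 * g + r * e * V + (ρ ^ 2 - 1) * s' * s ^ 3), ?_⟩
      linear_combination he + 2 * X * r * V * hse + 2 ^ (j + 2) * X * r ^ 2 * hg
        + 2 ^ (j + 2) * X * (ρ ^ 2 - 1) * s ^ 3 * hs'
    · right
      refine h.two.pow_dvd_of_dvd_mul_right _ hodd ?_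
      refine ⟨X * r * e * V, ?_⟩
      linear_combination he + 2 * X * r * V * hse
theorem Good.odd_int (h : Good O ρ) {n : ℤ} (hn : Odd n) : ¬ (2 : O) ∣ (n : O) := by
  obtain ⟨k, rfl⟩ := hn
  rintro ⟨c, hc⟩
  push_cast at hc
  exact h.nd isUnit_one ⟨c - k, by linear_combination hc⟩

theorem exists_gcd [IsDomain O] [IsPrincipalIdealRing O] {a b : O} (ha : a ≠ 0) :
    ∃ g a' b' : O, g ≠ 0 ∧ a = g * a' ∧ b = g * b' ∧ IsCoprime a' b' := by
  obtain ⟨g, hg⟩ := (IsPrincipalIdealRing.principal (Ideal.span {a, b})).principal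
  have hg' : Ideal.span {a, b} = Ideal.span {g} := hg
  have h1 : a ∈ Ideal.span {g} := by rw [← hg']; exact Ideal.subset_span (by simp)
  have h2 : b ∈ Ideal.span {g} := by rw [← hg']; exact Ideal.subset_span (by simp)
  have h3 : g ∈ Ideal.span {a, b} := by rw [hg']; exact Ideal.subset_span (by simp)
  obtain ⟨a', ha'⟩ := Ideal.mem_span_singleton.1 h1
  obtain ⟨b', hb'⟩ := Ideal.mem_span_singleton.1 h2
  obtain ⟨u, v, huv⟩ := Ideal.mem_span_pair.1 h3
  have hg0 : g ≠ 0 := by rintro rfl; exact ha (by rw [ha']; ring)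
  refine ⟨g, a', b', hg0, ha', hb', u, v, ?_⟩
  apply mul_left_cancel₀ hg0
  linear_combination huv - u * ha' - v * hb'

/-- The pull-back to the isogenous point for two odd integers. -/
theorem oddcase1 (h : Good O ρ) [IsDomain O] [IsPrincipalIdealRing O] {X Z μ : ℤ} {n : ℕ} {ω : O}
    (hX : Odd X) (hZ : Odd Z) (hμ : Odd μ) (hω : ¬ (2 : O) ∣ ω)
    (hK : X ^ 2 = Z ^ 2 + 4 * (2 ^ (n + 1) * μ))
    (hR : ω ^ 2 + ρ ^ 2 * X * Z * ω =
      (2 ^ (n + 1) * μ) * ((2 - ρ ^ 2) * Z ^ 2 + 4 * (2 ^ (n + 1) * μ))) : False := by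
  obtain ⟨K, hKd⟩ : ∃ K : O, K = 2 ^ (n + 1) * μ := ⟨_, rfl⟩
  have hX2 : (X : O) ^ 2 = Z ^ 2 + 4 * K := by
    rw [hKd]; exact_mod_cast congrArg (Int.cast (R := O)) hK
  rw [← hKd] at hR
  obtain ⟨y, hyd⟩ : ∃ y : O, y = (ρ ^ 2 - 2) * X * Z * K + ρ ^ 2 * ω * (Z ^ 2 + 2 * K) := ⟨_, rfl⟩
  have hy : y ^ 2 = ω ^ 4 + ρ * ω ^ 2 * (2 * K) ^ 2 + (ρ ^ 2 - 1) * (2 * K) ^ 4 := by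
    rw [hyd]
    linear_combination (-ω ^ 2 + ρ ^ 2 * X * Z * ω + 4 * ρ ^ 2 * K ^ 2
      - K * ((2 - ρ ^ 2) * Z ^ 2 + 4 * K)) * hR + 4 * K ^ 2 * ω ^ 2 * ρ * h.cube
      + ((ρ ^ 2 - 2) ^ 2 * K ^ 2 * Z ^ 2 - ρ ^ 4 * Z ^ 2 * ω ^ 2) * hX2
  have hω0 : ω ≠ 0 := by rintro rfl; exact hω (dvd_zero _)
  obtain ⟨g, x', z', hg0, hx', hz', hc⟩ := exists_gcd (b := 2 * K) hω0
  have hgy : g ^ 2 ∣ y := by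
    rw [← IsIntegrallyClosed.pow_dvd_pow_iff (n := 2) two_ne_zero]
    refine ⟨x' ^ 4 + ρ * x' ^ 2 * z' ^ 2 + (ρ ^ 2 - 1) * z' ^ 4, ?_⟩
    rw [hy, hz', hx']; ring
  obtain ⟨V, hV⟩ := hgy
  have hV2 : V ^ 2 = x' ^ 4 + ρ * x' ^ 2 * z' ^ 2 + (ρ ^ 2 - 1) * z' ^ 4 := by
    apply mul_left_cancel₀ (pow_ne_zero 4 hg0)
    rw [hV, hz', hx'] at hy
    linear_combination hy
  have hg2 : ¬ (2 : O) ∣ g := fun hd => hω (by rw [hx']; exact hd.mul_right _)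
  have hμ2 := h.odd_int hμ
  have hz2 : (2 : O) ^ (n + 1 + 1) ∣ z' := by
    refine h.two.pow_dvd_of_dvd_mul_left _ hg2 ⟨μ, ?_⟩
    rw [← hz', hKd]; ring
  have h2n : (2 : O) ^ (n + 2) ≠ 0 := pow_ne_zero _ h.two.ne_zero
  rcases L2 h (n + 1) hc hV2 hz2 with ⟨e, he⟩ | ⟨e, he⟩
  · have h1 : (μ : O) - ω = 2 * (g * e) := by
      apply mul_left_cancel₀ h2n
      rw [hKd] at hz'
      linear_combination hz' + g * he - 2 ^ (n + 2) * hx'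
    have h2 : (2 : O) ∣ ω * (ω + ρ ^ 2 * X * Z) := by
      refine ⟨2 ^ n * μ * ((2 - ρ ^ 2) * Z ^ 2 + 4 * K), ?_⟩
      linear_combination hR + ((2 - ρ ^ 2) * Z ^ 2 + 4 * K) * hKd
    obtain ⟨f, hf⟩ := (h.two.dvd_or_dvd h2).resolve_left hω
    obtain ⟨m, hm⟩ := hμ
    obtain ⟨x, hx⟩ := hX
    obtain ⟨z, hz⟩ := hZ
    apply h.nd h.unit'
    rw [hm] at h1
    rw [hx, hz] at hf
    push_cast at h1 hf
    exact ⟨f - m - ρ ^ 2 * (2 * x * z + x + z) + g * e - 1, by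
      linear_combination hf + h1⟩
  · apply hμ2
    refine ⟨g * e, ?_⟩
    apply mul_left_cancel₀ h2n
    rw [hKd] at hz'
    linear_combination hz' + g * he

theorem oddcase (h : Good O ρ) [IsDomain O] [IsPrincipalIdealRing O] {X Z : ℤ} {W : O}
    (hX : Odd X) (hZ : Odd Z)
    (hW : W ^ 2 = (X : O) ^ 4 + ρ * X ^ 2 * Z ^ 2 + (ρ ^ 2 - 1) * Z ^ 4) : X ^ 2 = Z ^ 2 := by
  by_contra hne
  obtain ⟨k, hk⟩ : (8 : ℤ) ∣ X ^ 2 - Z ^ 2 := by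
    have := Int.eight_dvd_sq_sub_one_of_odd hX
    have := Int.eight_dvd_sq_sub_one_of_odd hZ
    omega
  have hk0 : k ≠ 0 := by rintro rfl; apply hne; linarith
  obtain ⟨n, μ, hμ, hkμ⟩ : ∃ (n : ℕ) (μ : ℤ), Odd μ ∧ k = 2 ^ n * μ := by
    obtain ⟨μ, h1, h2⟩ := (FiniteMultiplicity.of_prime_left
      Int.prime_two hk0).exists_eq_pow_mul_and_not_dvd
    exact ⟨_, μ, by rw [← Int.not_even_iff_odd, even_iff_two_dvd]; exact h2, h1⟩
  have hK : X ^ 2 = Z ^ 2 + 4 * (2 ^ (n + 1) * μ) := by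
    rw [hkμ] at hk; linear_combination hk
  have hX2 : (X : O) ^ 2 = Z ^ 2 + 4 * (2 ^ (n + 1) * μ) := by
    exact_mod_cast congrArg (Int.cast (R := O)) hK
  have h1 : (2 : O) ∣ W - ρ ^ 2 * X * Z := by
    apply h.sq2
    refine ⟨2 * (2 ^ (n + 1) * μ) * (X ^ 2 - (ρ ^ 2 - 1) * Z ^ 2), ?_⟩
    linear_combination hW + (X ^ 2 - (ρ ^ 2 - 1) * Z ^ 2) * hX2 - ρ * X ^ 2 * Z ^ 2 * h.cube
  obtain ⟨ω, hω⟩ := h1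
  have hR : ω ^ 2 + ρ ^ 2 * X * Z * ω =
      (2 ^ (n + 1) * μ) * ((2 - ρ ^ 2) * Z ^ 2 + 4 * (2 ^ (n + 1) * μ)) := by
    apply mul_left_cancel₀ h.two.ne_zero
    apply mul_left_cancel₀ h.two.ne_zero
    obtain rfl : W = ρ ^ 2 * X * Z + 2 * ω := by linear_combination hω
    linear_combination hW + (X ^ 2 - (ρ ^ 2 - 1) * Z ^ 2 + 4 * (2 ^ (n + 1) * μ)) * hX2 - ρ * X ^ 2 * Z ^ 2 * h.cube
  by_cases h2 : (2 : O) ∣ ω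
  · refine oddcase1 h (ω := -ω - ρ ^ 2 * X * Z) hX hZ hμ ?_ hK (by rw [← hR]; ring)
    intro h3
    apply h.odd_mul (h.odd_mul (h.nd (h.unit.pow 2)) (h.odd_int hX)) (h.odd_int hZ)
    have := dvd_add h2 h3
    rw [← dvd_neg]
    convert this using 1; ring
  · exact oddcase1 h hX hZ hμ h2 hK hR

theorem zmod23 : ∀ x z : ZMod 23, 3 * x ^ 2 + 2 * z ^ 2 = 0 → x = 0 ∧ z = 0 := by decide

theorem intfact {X Z : ℤ} (hc : IsCoprime X Z) : ¬ (23 : ℤ) ∣ 3 * X ^ 2 + 2 * Z ^ 2 := by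
  intro hd
  have h1 := (ZMod.intCast_zmod_eq_zero_iff_dvd (3 * X ^ 2 + 2 * Z ^ 2) 23).2 hd
  push_cast at h1
  obtain ⟨h2, h3⟩ := zmod23 _ _ h1
  have h4 := (ZMod.intCast_zmod_eq_zero_iff_dvd X 23).1 h2
  have h5 := (ZMod.intCast_zmod_eq_zero_iff_dvd Z 23).1 h3
  have := hc.isUnit_of_dvd' h4 h5
  rw [Int.isUnit_iff] at this
  omega

theorem AB_coprime (h : Good O ρ) [IsDomain O] [IsPrincipalIdealRing O] {X Z : ℤ}
    (hc : IsCoprime X Z) (hne : (X : O) ^ 2 - (ρ ^ 2 - 1) * Z ^ 2 ≠ 0) :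
    IsCoprime ((X : O) ^ 2 - (ρ ^ 2 - 1) * Z ^ 2)
      (X ^ 4 + ρ ^ 2 * X ^ 2 * Z ^ 2 + ρ * Z ^ 4) := by
  have hcO : IsCoprime (X : O) (Z : O) := hc.map (Int.castRingHom O)
  apply isCoprime_of_prime_dvd
  · exact fun h0 => hne h0.1
  intro π hπ hA hB
  have hZ : ¬ π ∣ (Z : O) := by
    intro hZ
    have : π ∣ (X : O) ^ 2 := by
      have := dvd_add hA ((dvd_pow hZ two_ne_zero).mul_left (ρ ^ 2 - 1))
      simpa using this
    exact hπ.not_isUnit (hcO.isUnit_of_dvd' (hπ.dvd_of_dvd_pow this) hZ)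
  have h1 : π ∣ (ρ ^ 2 - 1) * (3 * ρ ^ 2 - 1) * Z ^ 4 := by
    have := dvd_sub hB (hA.mul_right (X ^ 2 + ((ρ ^ 2 - 1) + ρ ^ 2) * Z ^ 2))
    convert this using 1
    linear_combination ρ * Z ^ 4 * h.cube
  have h2 : π ∣ 3 * ρ ^ 2 - 1 := by
    rcases hπ.dvd_or_dvd h1 with h2 | h2
    · rcases hπ.dvd_or_dvd h2 with h3 | h3
      · exact (hπ.not_isUnit (isUnit_of_dvd_unit h3 h.unit')).elim
      · exact h3
    · exact (hZ (hπ.dvd_of_dvd_pow h2)).elim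
  have h3 : π ∣ ((23 : ℤ) : O) := by
    have : ((23 : ℤ) : O) = (3 * ρ ^ 2 - 1) * (-6 * ρ ^ 2 + 9 * ρ + 4) := by
      push_cast
      linear_combination (18 * ρ - 27) * h.cube
    rw [this]; exact h2.mul_right _
  have h4 : π ∣ ((3 * X ^ 2 + 2 * Z ^ 2 : ℤ) : O) := by
    have := dvd_add (hA.mul_left 3) (h2.mul_right ((Z : O) ^ 2))
    convert this using 1
    push_cast; ring
  have h5 : IsCoprime (23 : ℤ) (3 * X ^ 2 + 2 * Z ^ 2) := by
    have hp : Prime (23 : ℤ) := Int.prime_iff_natAbs_prime.2 (by norm_num)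
    exact (hp.irreducible.coprime_iff_not_dvd).2 (intfact hc)
  exact hπ.not_isUnit ((h5.map (Int.castRingHom O)).isUnit_of_dvd' h3 h4)

theorem main_int (h : Good O ρ) [IsDomain O] [IsPrincipalIdealRing O] {X Y Z : ℤ}
    (hc : IsCoprime X Z) (hZ0 : Z ≠ 0) (hY : Y ^ 2 = X ^ 6 + X ^ 4 * Z ^ 2 - Z ^ 6) :
    X ^ 2 = Z ^ 2 := by
  have hX : Odd X := by
    by_contra hX
    rw [Int.not_odd_iff_even] at hX
    have hZ : Odd Z := by
      by_contra hZ
      rw [Int.not_odd_iff_even] at hZ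
      have := hc.isUnit_of_dvd' hX.two_dvd hZ.two_dvd
      rw [Int.isUnit_iff] at this
      omega
    obtain ⟨x, hx⟩ := hX.two_dvd
    obtain ⟨k, hk⟩ := Int.eight_dvd_sq_sub_one_of_odd (hZ.pow (n := 3))
    have e : Y ^ 2 = 4 * (16 * x ^ 6 + 4 * x ^ 4 * Z ^ 2 - 2 * k) - 1 := by
      rw [hx] at hY
      linear_combination hY - hk
    have h3 := Int.sq_mod_four_eq_one_of_odd (x := Y)
    rcases Int.even_or_odd Y with hYe | hYo
    · obtain ⟨y, hy⟩ := hYe.two_dvd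
      rw [hy] at e
      have : (2 * y) ^ 2 = 4 * y ^ 2 := by ring
      omega
    · have := h3 hYo
      omega
  have hYodd : Odd Y := by
    have : Odd (Y ^ 2) := by
      rw [hY]
      rcases Int.even_or_odd Z with hZ | hZ
      · have e1 : Even (X ^ 4 * Z ^ 2 - Z ^ 6) := by
          apply Even.sub
          · exact (hZ.pow_of_ne_zero two_ne_zero).mul_left _
          · exact hZ.pow_of_ne_zero (by norm_num)
        have := (hX.pow (n := 6)).add_even e1
        convert this using 1; ring
      · exact ((hX.pow (n := 6)).add_odd ((hX.pow (n := 4)).mul (hZ.pow (n := 2)))).sub_odd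
          (hZ.pow (n := 6))
    rwa [Int.odd_pow' two_ne_zero] at this
  have hYO := h.odd_int hYodd
  have hY0 : (Y : O) ≠ 0 := by intro h0; rw [h0] at hYO; exact hYO (dvd_zero _)
  have hYc : (Y : O) ^ 2 = X ^ 6 + X ^ 4 * Z ^ 2 - Z ^ 6 := by
    exact_mod_cast congrArg (Int.cast (R := O)) hY
  have hfac : ((X : O) ^ 2 - (ρ ^ 2 - 1) * Z ^ 2) * (X ^ 4 + ρ ^ 2 * X ^ 2 * Z ^ 2 + ρ * Z ^ 4)
      = Y ^ 2 := by
    rw [hYc]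
    linear_combination (-Z ^ 6 - ρ * X ^ 2 * Z ^ 4) * h.cube
  have hA0 : (X : O) ^ 2 - (ρ ^ 2 - 1) * Z ^ 2 ≠ 0 := by
    intro h0
    rw [h0, zero_mul] at hfac
    exact hY0 (pow_eq_zero_iff two_ne_zero |>.1 hfac.symm)
  obtain ⟨c, p, q, hAp, hYpq, hBq, -⟩ := split 1 (AB_coprime h hc hA0) hY0 (by rw [hfac]; simp)
  rw [Units.val_one, one_mul] at hBq
  have hp : ¬ (2 : O) ∣ p := fun hd => hYO (by rw [hYpq]; exact hd.mul_right _)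
  have hcO : IsCoprime (X : O) (Z : O) := hc.map (Int.castRingHom O)
  rcases Int.even_or_odd Z with hZ | hZ
  · exfalso
    obtain ⟨z, hz⟩ := hZ.two_dvd
    obtain ⟨w, hw⟩ := h.usq (u := c) (q := X) hp ⟨-(ρ ^ 2 - 1) * z ^ 2, by
      rw [hz] at hAp; push_cast at hAp; linear_combination -hAp⟩
    have h1 : ((w⁻¹ : Oˣ) : O) * w = 1 := by simp
    have := L1 h (W := q * (w⁻¹ : Oˣ)) hcO (by
      rw [hw] at hBq
      generalize ((w⁻¹ : Oˣ) : O) = v at *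
      linear_combination (-v ^ 2) * hBq + ((X : O) ^ 4 + ρ ^ 2 * X ^ 2 * Z ^ 2 + ρ * Z ^ 4) * (v * w + 1) * h1)
    obtain ⟨σ, hσ⟩ := h.real
    apply hZ0
    have h2 : σ (Z : O) = 0 := by rw [this]; simp
    simpa using h2
  · obtain ⟨k, hk⟩ : (8 : ℤ) ∣ X ^ 2 - Z ^ 2 := by
      have := Int.eight_dvd_sq_sub_one_of_odd hX
      have := Int.eight_dvd_sq_sub_one_of_odd hZ
      omega
    have hk' : (X : O) ^ 2 - Z ^ 2 = 8 * k := by exact_mod_cast congrArg (Int.cast (R := O)) hk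
    obtain ⟨u, hu⟩ := h.unit
    obtain ⟨w, hw⟩ := h.usq (u := u * c) (p := p) (q := (ρ ^ 2 - 1) ^ 2 * Z) hp
      ⟨2 * ρ * k, by
        push_cast
        rw [hu]
        linear_combination (-ρ) * hAp + ρ * hk' + Z ^ 2 * ((1) * ρ ^ 0 + (-3) * ρ ^ 1 + (-1) * ρ ^ 2 + (3) * ρ ^ 3 + (-1) * ρ ^ 5) * h.cube⟩
    push_cast at hw
    rw [hu] at hw
    have h1 : ((w⁻¹ : Oˣ) : O) * w = 1 := by simp
    refine (oddcase h (W := q * (w⁻¹ : Oˣ)) hZ hX ?_).symm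
    generalize ((w⁻¹ : Oˣ) : O) = v at *
    have h2 : w ^ 2 * ((Z : O) ^ 4 + ρ * Z ^ 2 * X ^ 2 + (ρ ^ 2 - 1) * X ^ 4) = q ^ 2 := by
      rw [← hBq, ← hw]
      linear_combination c * X ^ 4 * h.cube
    linear_combination (-v ^ 2) * h2 + ((Z : O) ^ 4 + ρ * Z ^ 2 * X ^ 2 + (ρ ^ 2 - 1) * X ^ 4) * (v * w + 1) * h1
/-- `O` is free over `ℤ` with basis `1, ρ, ρ ^ 2`. -/
structure Coord (O : Type*) [CommRing O] (ρ : O) : Prop where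
  cube : ρ ^ 3 = ρ + 1
  span : ∀ z : O, ∃ a b c : ℤ, z = a + b * ρ + c * ρ ^ 2
  ind : ∀ a b c : ℤ, (a : O) + b * ρ + c * ρ ^ 2 = 0 → a = 0 ∧ b = 0 ∧ c = 0

theorem Coord.eq (h : Coord O ρ) {a b c a' b' c' : ℤ}
    (he : (a : O) + b * ρ + c * ρ ^ 2 = a' + b' * ρ + c' * ρ ^ 2) : a = a' ∧ b = b' ∧ c = c' := by
  have := h.ind (a - a') (b - b') (c - c') (by push_cast; linear_combination he)
  omega

theorem Coord.mul (h : Coord O ρ) (a b c d e f : ℤ) :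
    ((a : O) + b * ρ + c * ρ ^ 2) * (d + e * ρ + f * ρ ^ 2) =
      ((a * d + b * f + c * e : ℤ) : O) + ((a * e + b * d + b * f + c * e + c * f : ℤ) : O) * ρ
        + ((a * f + b * e + c * d + c * f : ℤ) : O) * ρ ^ 2 := by
  push_cast
  linear_combination (b * f + c * e + c * f * ρ : O) * h.cube

theorem Coord.two_dvd (h : Coord O ρ) {a b c : ℤ} (hd : (2 : O) ∣ a + b * ρ + c * ρ ^ 2) :
    2 ∣ a ∧ 2 ∣ b ∧ 2 ∣ c := by
  obtain ⟨z, hz⟩ := hd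
  obtain ⟨d, e, f, rfl⟩ := h.span z
  obtain ⟨h1, h2, h3⟩ := h.eq (a' := 2 * d) (b' := 2 * e) (c' := 2 * f)
    (by rw [hz]; push_cast; ring)
  exact ⟨⟨d, h1⟩, ⟨e, h2⟩, ⟨f, h3⟩⟩

set_option synthInstance.maxSize 4000 in
set_option synthInstance.maxHeartbeats 400000 in
theorem zmod2 : ∀ a b c d e f : ZMod 2, a * d + b * f + c * e = 0 →
    a * e + b * d + b * f + c * e + c * f = 0 → a * f + b * e + c * d + c * f = 0 →
    (a = 0 ∧ b = 0 ∧ c = 0) ∨ (d = 0 ∧ e = 0 ∧ f = 0) := by decide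

theorem Coord.even (_ : Coord O ρ) {a b c : ℤ} (hd : (a : ZMod 2) = 0 ∧ (b : ZMod 2) = 0 ∧
    (c : ZMod 2) = 0) : (2 : O) ∣ a + b * ρ + c * ρ ^ 2 := by
  simp only [ZMod.intCast_zmod_eq_zero_iff_dvd] at hd
  obtain ⟨⟨x, rfl⟩, ⟨y, rfl⟩, ⟨z, rfl⟩⟩ := hd
  exact ⟨x + y * ρ + z * ρ ^ 2, by push_cast; ring⟩

theorem Coord.two (h : Coord O ρ) : Prime (2 : O) := by
  refine ⟨?_, ?_, ?_⟩
  · intro h0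
    have := h.ind 2 0 0 (by push_cast; rw [h0]; ring)
    omega
  · intro hu
    have := h.two_dvd (a := 1) (b := 0) (c := 0) (by
      push_cast; exact hu.dvd)
    omega
  · intro x y hd
    obtain ⟨a, b, c, rfl⟩ := h.span x
    obtain ⟨d, e, f, rfl⟩ := h.span y
    rw [h.mul] at hd
    obtain ⟨h1, h2, h3⟩ := h.two_dvd hd
    have e1 := (ZMod.intCast_zmod_eq_zero_iff_dvd _ 2).2 h1
    have e2 := (ZMod.intCast_zmod_eq_zero_iff_dvd _ 2).2 h2
    have e3 := (ZMod.intCast_zmod_eq_zero_iff_dvd _ 2).2 h3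
    push_cast at e1 e2 e3
    rcases zmod2 _ _ _ _ _ _ e1 e2 e3 with h4 | h4
    · exact Or.inl (h.even h4)
    · exact Or.inr (h.even h4)

theorem Coord.dvd23 (h : Coord O ρ) (a b c : ℤ) :
    ρ - 3 ∣ (a + b * ρ + c * ρ ^ 2 : O) ↔ 23 ∣ a + 3 * b + 9 * c := by
  constructor
  · rintro ⟨z, hz⟩
    obtain ⟨d, e, f, rfl⟩ := h.span z
    obtain ⟨h1, h2, h3⟩ := h.eq (a' := -3 * d + f) (b' := d - 3 * e + f) (c' := e - 3 * f)
      (by rw [hz]; push_cast; linear_combination (f : O) * h.cube)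
    exact ⟨-f, by rw [h1, h2, h3]; ring⟩
  · rintro ⟨k, hk⟩
    have hk' : (a : O) + 3 * b + 9 * c = 23 * k := by exact_mod_cast congrArg (Int.cast (R := O)) hk
    refine ⟨b + c * (ρ + 3) - k * (ρ ^ 2 + 3 * ρ + 8), ?_⟩
    linear_combination hk' + (k : O) * h.cube

theorem Coord.p23 (h : Coord O ρ) : Prime (ρ - 3) := by
  have hp : Prime (23 : ℤ) := Int.prime_iff_natAbs_prime.2 (by norm_num)
  refine ⟨?_, ?_, ?_⟩
  · intro h0
    have := h.ind (-3) 1 0 (by push_cast; linear_combination h0)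
    omega
  · intro hu
    have := (h.dvd23 1 0 0).1 hu.dvd
    omega
  · intro x y hd
    obtain ⟨a, b, c, rfl⟩ := h.span x
    obtain ⟨d, e, f, rfl⟩ := h.span y
    rw [h.mul, h.dvd23] at hd
    rw [h.dvd23, h.dvd23]
    apply hp.dvd_or_dvd
    obtain ⟨k, hk⟩ := hd
    exact ⟨k + b * f + c * e + 3 * c * f, by linear_combination hk⟩

theorem Coord.rho_nsq (h : Coord O ρ) (w : O) : ρ ≠ w ^ 2 ∧ ρ ≠ -w ^ 2 := by
  obtain ⟨a, b, c, rfl⟩ := h.span w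
  have key : ∀ s : ℤ, s = 1 ∨ s = -1 →
      ρ ≠ s * ((a : O) + b * ρ + c * ρ ^ 2) ^ 2 := by
    intro s hs hw
    rw [pow_two, h.mul] at hw
    obtain ⟨h1, h2, h3⟩ := h.eq (a := 0) (b := 1) (c := 0)
      (a' := s * (a * a + b * c + c * b)) (b' := s * (a * b + b * a + b * c + c * b + c * c))
      (c' := s * (a * c + b * b + c * a + c * c)) (by
        push_cast at hw ⊢; linear_combination hw)
    have g1 : a * a + 2 * (b * c) = 0 := by rcases hs with rfl | rfl <;> linarith
    have g2 : c * c + 2 * (a * b + b * c) = s := by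
      rcases hs with rfl | rfl <;> linarith
    have g3 : b * b + c * c + 2 * (a * c) = 0 := by rcases hs with rfl | rfl <;> linarith
    have ea : Even a := by
      have : Even (a * a) := ⟨-(b * c), by linarith⟩
      simpa [Int.even_mul] using this
    have oc : Odd (c * c) := by
      rw [← Int.not_even_iff_odd]
      rintro ⟨k, hk⟩
      omega
    have ob : Odd (b * b) := by
      obtain ⟨k, hk⟩ := oc
      exact ⟨-k - a * c - 1, by linarith⟩
    have obc : Odd (b * c) := by
      rw [Int.odd_mul] at *
      exact ⟨ob.1, oc.1⟩
    obtain ⟨k, hk⟩ := obc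
    obtain ⟨m, hm⟩ := ea
    have : a * a = 4 * (m * m) := by rw [hm]; ring
    omega
  exact ⟨by simpa using key 1 (by simp), by simpa using key (-1) (by simp)⟩

theorem Coord.unitsOf (h : Coord O ρ) (ε : Oˣ)
    (hε : ∀ u : Oˣ, ∃ k : ℤ, u = ε ^ k ∨ u = -ε ^ k) :
    ∀ u : Oˣ, ∃ w : Oˣ, (u : O) = w ^ 2 ∨ (u : O) = -w ^ 2 ∨ (u : O) = ρ * w ^ 2 ∨
    (u : O) = -(ρ * w ^ 2) := by
  have hu : IsUnit ρ := IsUnit.of_mul_eq_one (ρ ^ 2 - 1) (by linear_combination h.cube)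
  obtain ⟨r, hr⟩ := hu
  obtain ⟨k, hk⟩ := hε r
  have hkodd : Odd k := by
    rw [← Int.not_even_iff_odd]
    rintro ⟨m, hm⟩
    have h2 := h.rho_nsq ((ε ^ m : Oˣ) : O)
    rw [hm, zpow_add] at hk
    rcases hk with hk | hk
    · apply h2.1; rw [← hr, hk]; push_cast; ring
    · apply h2.2; rw [← hr, hk]; push_cast; ring
  obtain ⟨n, hn⟩ := hkodd
  intro u
  obtain ⟨j, hj⟩ := hε u
  rcases Int.even_or_odd j with ⟨m, hm⟩ | ⟨m, hm⟩
  · refine ⟨ε ^ m, ?_⟩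
    rw [hm, zpow_add] at hj
    rcases hj with hj | hj
    · left; rw [hj]; push_cast; ring
    · right; left; rw [hj]; push_cast; ring
  · refine ⟨ε ^ (m - n), ?_⟩
    have e1 : ε ^ j = ε ^ k * (ε ^ (m - n)) ^ 2 := by
      rw [hm, hn, pow_two, ← zpow_add, ← zpow_add]; congr 1; ring
    rcases hk with hk | hk
    · have e2 : ε ^ j = r * (ε ^ (m - n)) ^ 2 := by rw [e1, hk]
      rcases hj with hj | hj
      · right; right; left; rw [hj, e2, ← hr]; push_cast; ring
      · right; right; right; rw [hj, e2, ← hr]; push_cast; ring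
    · have e2 : ε ^ j = -(r * (ε ^ (m - n)) ^ 2) := by rw [e1, hk]; simp
      rcases hj with hj | hj
      · right; right; right; rw [hj, e2, ← hr]; push_cast; ring
      · right; right; left; rw [hj, e2, ← hr]; push_cast; ring

section NF

open NumberField Module

variable {K : Type*} [Field K] [NumberField K] {θ : K} (b : Basis (Fin 3) ℚ K)

theorem leftMul (hθ : θ ^ 3 = θ + 1) (hb : ∀ i : Fin 3, b i = θ ^ (i : ℕ)) :
    Algebra.leftMulMatrix b θ = !![0, 0, 1; 1, 0, 1; 0, 1, 0] := by
  have h0 : b 0 = 1 := by rw [hb]; simp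
  have h1 : b 1 = θ := by rw [hb]; simp
  have h2 : b 2 = θ ^ 2 := by rw [hb]; simp
  have e0 : θ * b 0 = b 1 := by rw [h0, h1]; ring
  have e1 : θ * b 1 = b 2 := by rw [h2, h1]; ring
  have e2 : θ * b 2 = b 0 + b 1 := by rw [h0, h1, h2]; linear_combination hθ
  ext i j
  rw [Algebra.leftMulMatrix_eq_repr_mul]
  fin_cases j
  · change (b.repr (θ * b 0)) i = _
    rw [e0]; fin_cases i <;> simp [Finsupp.single_apply]
  · change (b.repr (θ * b 1)) i = _
    rw [e1]; fin_cases i <;> simp [Finsupp.single_apply]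
  · change (b.repr (θ * b 2)) i = _
    rw [e2]; fin_cases i <;> simp [Finsupp.single_apply]

theorem traces (hθ : θ ^ 3 = θ + 1) (hb : ∀ i : Fin 3, b i = θ ^ (i : ℕ)) (n : ℕ) :
    Algebra.trace ℚ K (θ ^ n) = Matrix.trace ((!![0, 0, 1; 1, 0, 1; 0, 1, 0] :
      Matrix (Fin 3) (Fin 3) ℚ) ^ n) := by
  rw [Algebra.trace_eq_matrix_trace b, map_pow, leftMul b hθ hb]

theorem discr_pow (hθ : θ ^ 3 = θ + 1) (hb : ∀ i : Fin 3, b i = θ ^ (i : ℕ)) {ρ : 𝓞 K}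
    (hρ : (ρ : K) = θ) : Algebra.discr ℤ (fun i : Fin 3 => ρ ^ (i : ℕ)) = -23 := by
  have ht : ∀ n : ℕ, ((Algebra.trace ℤ (𝓞 K) (ρ ^ n) : ℤ) : ℚ) =
      Matrix.trace ((!![0, 0, 1; 1, 0, 1; 0, 1, 0] : Matrix (Fin 3) (Fin 3) ℚ) ^ n) := by
    intro n
    rw [Algebra.coe_trace_int, ← traces b hθ hb, ← hρ]
    simp
  have t0 : Algebra.trace ℤ (𝓞 K) (ρ ^ 0) = 3 := by
    have h : ((Algebra.trace ℤ (𝓞 K) (ρ ^ 0) : ℤ) : ℚ) = ((3 : ℤ) : ℚ) := by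
      rw [ht 0, pow_zero, Matrix.trace_one, Fintype.card_fin]; norm_num
    exact Int.cast_injective h
  have t1 : Algebra.trace ℤ (𝓞 K) (ρ ^ 1) = 0 := by
    have := ht 1
    rw [pow_one, Matrix.trace_fin_three] at this
    norm_num at this
    simpa using this
  have t2 : Algebra.trace ℤ (𝓞 K) (ρ ^ 2) = 2 := by
    have := ht 2
    rw [pow_two (!![0, 0, 1; 1, 0, 1; 0, 1, 0] : Matrix (Fin 3) (Fin 3) ℚ),
      Matrix.trace_fin_three] at this
    simp [Matrix.mul_apply, Fin.sum_univ_three] at this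
    norm_num at this
    exact_mod_cast this
  have hc : ρ ^ 3 = ρ + 1 := by
    apply RingOfIntegers.coe_injective
    rw [map_pow, map_add, map_one]
    have h : algebraMap (𝓞 K) K ρ = θ := hρ
    rw [h, hθ]
  have t3 : Algebra.trace ℤ (𝓞 K) (ρ ^ 3) = 3 := by
    have : ρ ^ 3 = ρ ^ 1 + ρ ^ 0 := by linear_combination hc
    rw [this, map_add, t1, t0]; norm_num
  have t4 : Algebra.trace ℤ (𝓞 K) (ρ ^ 4) = 2 := by
    have : ρ ^ 4 = ρ ^ 2 + ρ ^ 1 := by linear_combination ρ * hc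
    rw [this, map_add, t1, t2]; norm_num
  rw [Algebra.discr_def, Matrix.det_fin_three]
  simp only [Algebra.traceMatrix_apply, Algebra.traceForm_apply, ← pow_add]
  simp only [Fin.val_zero, Fin.val_one, Fin.val_two]
  have t0' : Algebra.trace ℤ (𝓞 K) 1 = 3 := by rw [← pow_zero ρ]; exact t0
  have t1' : Algebra.trace ℤ (𝓞 K) ρ = 0 := by rw [← pow_one ρ]; exact t1
  norm_num [t2, t3, t4]
  rw [t0', t1']; norm_num

theorem coordNF (hθ : θ ^ 3 = θ + 1) (hb : ∀ i : Fin 3, b i = θ ^ (i : ℕ)) {ρ : 𝓞 K}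
    (hρ : (ρ : K) = θ) : Coord (𝓞 K) ρ ∧ NumberField.discr K = -23 := by
  have hc : ρ ^ 3 = ρ + 1 := by
    apply RingOfIntegers.coe_injective
    rw [map_pow, map_add, map_one]
    have h : algebraMap (𝓞 K) K ρ = θ := hρ
    rw [h, hθ]
  have hfr : finrank ℤ (𝓞 K) = 3 := by
    rw [RingOfIntegers.rank, finrank_eq_card_basis b]; simp
  let B : Basis (Fin 3) ℤ (𝓞 K) := finBasisOfFinrankEq ℤ (𝓞 K) hfr
  let v : Fin 3 → 𝓞 K := fun i => ρ ^ (i : ℕ)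
  have h1 := Algebra.discr_of_matrix_vecMul (A := ℤ) B (B.toMatrix v)
  rw [Basis.toMatrix_map_vecMul, discr_pow b hθ hb hρ, NumberField.discr_eq_discr] at h1
  have hdet : IsUnit (B.toMatrix v).det := by
    have hp : Prime (23 : ℤ) := Int.prime_iff_natAbs_prime.2 (by norm_num)
    by_contra hn
    rcases hp.irreducible.isUnit_or_isUnit (a := (B.toMatrix v).det)
      (b := (B.toMatrix v).det * (-NumberField.discr K)) (by linear_combination -h1) with h2 | h2
    · exact hn h2
    · exact hn (isUnit_of_mul_isUnit_left h2)
  have h2 := (B.is_basis_iff_det (v := v)).2 (by rw [Basis.det_apply]; exact hdet)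
  refine ⟨⟨hc, ?_, ?_⟩, ?_⟩
  · intro z
    have hz : z ∈ Submodule.span ℤ (Set.range v) := by rw [h2.2]; trivial
    rw [Submodule.mem_span_range_iff_exists_fun] at hz
    obtain ⟨c, hc⟩ := hz
    refine ⟨c 0, c 1, c 2, ?_⟩
    rw [← hc, Fin.sum_univ_three]
    simp [v]
  · intro x y z h0
    have := Fintype.linearIndependent_iff.1 h2.1 ![x, y, z] (by
      rw [Fin.sum_univ_three]
      simpa [v] using h0)
    exact ⟨this 0, this 1, this 2⟩
  · rcases Int.isUnit_iff.1 hdet with h3 | h3 <;> rw [h3] at h1 <;> linarith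

theorem goodNF (hθ : θ ^ 3 = θ + 1) (hb : ∀ i : Fin 3, b i = θ ^ (i : ℕ)) {ρ : 𝓞 K}
    (hρ : (ρ : K) = θ) (f : K →+* ℝ) : Good (𝓞 K) ρ ∧ IsPrincipalIdealRing (𝓞 K) := by
  obtain ⟨hC, hd⟩ := coordNF b hθ hb hρ
  have hfr : finrank ℚ K = 3 := by rw [finrank_eq_card_basis b]; simp
  have hr := InfinitePlace.card_add_two_mul_card_eq_rank K
  have hs := NumberField.sign_discr K
  rw [hfr] at hr
  have hcp : InfinitePlace.nrComplexPlaces K = 1 := by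
    have : InfinitePlace.nrComplexPlaces K = 0 ∨ InfinitePlace.nrComplexPlaces K = 1 := by omega
    rcases this with h0 | h0
    · rw [h0, hd] at hs
      exact absurd hs (by decide)
    · exact h0
  have hrank : Units.rank K = 1 := by
    rw [Units.rank, InfinitePlace.card_eq_nrRealPlaces_add_nrComplexPlaces]
    omega
  obtain ⟨ε, hε⟩ : ∃ ε : (𝓞 K)ˣ, ∀ u : (𝓞 K)ˣ, ∃ k : ℤ, u = ε ^ k ∨ u = -ε ^ k := by
    obtain ⟨hU⟩ : Nonempty (Unique (Fin (Units.rank K))) := by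
      rw [← Fintype.card_eq_one_iff_nonempty_unique]; simpa using hrank
    refine ⟨Units.fundSystem K default, fun u => ?_⟩
    obtain ⟨⟨ζ, e⟩, hu, -⟩ := Units.exist_unique_eq_mul_prod K u
    refine ⟨e default, ?_⟩
    rw [Fintype.prod_unique] at hu
    rcases Units.torsion_eq_one_or_neg_one_of_odd_finrank (K := K) (by rw [hfr]; decide) ζ
      with h1 | h1
    · left; simpa [h1] using hu
    · right; simpa [h1] using hu
  refine ⟨⟨hC.cube, hC.two, hC.p23, hC.unitsOf ε hε,
    f.comp (algebraMap (𝓞 K) K), ?_⟩, ?_⟩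
  · rw [RingHom.coe_comp]
    exact f.injective.comp RingOfIntegers.coe_injective
  · apply RingOfIntegers.isPrincipalIdealRing_of_abs_discr_lt
    rw [hd, hfr, hcp]
    have hf : ((Nat.factorial 3 : ℕ) : ℝ) = 6 := by norm_num [Nat.factorial]
    rw [hf]
    have := Real.pi_gt_three
    norm_num
    nlinarith

end NF

theorem exists_good : ∃ (O : Type) (_ : CommRing O) (ρ : O), Good O ρ ∧ IsDomain O ∧
    IsPrincipalIdealRing O := by
  have hirr : Irreducible (Polynomial.X ^ 3 - Polynomial.X - 1 : Polynomial ℚ) :=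
    Polynomial.X_pow_sub_X_sub_one_irreducible_rat (by norm_num)
  obtain ⟨P, hP⟩ : ∃ P : Polynomial ℚ, P = Polynomial.X ^ 3 - Polynomial.X - 1 := ⟨_, rfl⟩
  rw [← hP] at hirr
  have hdeg : P.natDegree = 3 := by rw [hP]; compute_degree!
  haveI : Fact (Irreducible P) := ⟨hirr⟩
  let pb := AdjoinRoot.powerBasis hirr.ne_zero
  haveI : FiniteDimensional ℚ (AdjoinRoot P) := pb.finite
  haveI : CharZero (AdjoinRoot P) := charZero_of_injective_algebraMap
    (algebraMap ℚ (AdjoinRoot P)).injective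
  haveI : NumberField (AdjoinRoot P) := ⟨⟩
  have hdim : pb.dim = 3 := by rw [← hdeg]; rfl
  have hroot : (AdjoinRoot.root P) ^ 3 = AdjoinRoot.root P + 1 := by
    have h2 : ∀ Q : Polynomial ℚ, Q = P → Q.eval₂ (AdjoinRoot.of P) (AdjoinRoot.root P) = 0 := by
      rintro _ rfl; exact AdjoinRoot.eval₂_root _
    have h2 := h2 _ hP.symm
    simp only [Polynomial.eval₂_sub, Polynomial.eval₂_pow, Polynomial.eval₂_X,
      Polynomial.eval₂_one] at h2
    linear_combination h2
  let b := pb.basis.reindex (finCongr hdim)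
  have hb : ∀ i : Fin 3, b i = AdjoinRoot.root P ^ (i : ℕ) := by
    intro i
    simp [b, pb]
  have hRootInt : IsIntegral ℤ (AdjoinRoot.root P) := by
    refine ⟨Polynomial.X ^ 3 - Polynomial.X - 1, by monicity!, ?_⟩
    simp; linear_combination hroot
  obtain ⟨t, ht⟩ : ∃ t : ℝ, t ^ 3 - t - 1 = 0 := by
    have := intermediate_value_Icc (a := (0 : ℝ)) (b := 2) (by norm_num)
      (f := fun t : ℝ => t ^ 3 - t - 1) (by fun_prop)
    obtain ⟨t, -, ht⟩ := this (show (0 : ℝ) ∈ _ by constructor <;> norm_num)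
    exact ⟨t, ht⟩
  let f : AdjoinRoot P →+* ℝ := AdjoinRoot.lift (algebraMap ℚ ℝ) t (by
    rw [hP]; simp; linarith)
  obtain ⟨h1, h2⟩ := goodNF b hroot hb (ρ := ⟨AdjoinRoot.root P, hRootInt⟩) rfl f
  exact ⟨_, _, _, h1, inferInstance, h2⟩

theorem main_int' {X Y Z : ℤ} (hc : IsCoprime X Z) (hZ0 : Z ≠ 0)
    (hY : Y ^ 2 = X ^ 6 + X ^ 4 * Z ^ 2 - Z ^ 6) : X ^ 2 = Z ^ 2 := by
  obtain ⟨O, _, ρ, h, _, _⟩ := exists_good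
  exact main_int h hc hZ0 hY

theorem main_rat {x y : ℚ} (h : y ^ 2 = x ^ 6 + x ^ 4 - 1) : x ^ 2 = 1 := by
  have hd : (x.den : ℚ) ≠ 0 := by exact_mod_cast x.den_ne_zero
  have hx : x * x.den = x.num := Rat.mul_den_eq_num x
  have h1 : (y * x.den ^ 3) ^ 2 = ((x.num ^ 6 + x.num ^ 4 * x.den ^ 2 - x.den ^ 6 : ℤ) : ℚ) := by
    push_cast
    rw [← hx, mul_pow, h]; ring
  obtain ⟨Y, hY⟩ : ∃ Y : ℤ, y * x.den ^ 3 = Y := by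
    have : IsIntegral ℤ (y * x.den ^ 3) := by
      apply IsIntegral.of_pow (n := 2) two_pos
      rw [h1]; exact isIntegral_algebraMap
    obtain ⟨Y, hY⟩ := IsIntegrallyClosed.isIntegral_iff.1 this
    exact ⟨Y, by rw [← hY]; simp⟩
  rw [hY] at h1
  have h2 : Y ^ 2 = x.num ^ 6 + x.num ^ 4 * (x.den : ℤ) ^ 2 - (x.den : ℤ) ^ 6 := by exact_mod_cast h1
  have h3 := main_int' (X := x.num) (Z := x.den)
    (Int.isCoprime_iff_gcd_eq_one.2 (by simpa [Int.gcd] using x.reduced))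
    (by exact_mod_cast x.den_ne_zero) h2
  have h4 : (x.num : ℚ) ^ 2 = (x.den : ℚ) ^ 2 := by exact_mod_cast h3
  rw [← hx] at h4
  apply mul_right_cancel₀ (pow_ne_zero 2 hd)
  linear_combination h4

end S14

theorem stmt_14 (x y : ℚ) :
    y ^ 2 = x ^ 6 + x ^ 4 - 1 ↔ (x = 1 ∨ x = -1) ∧ (y = 1 ∨ y = -1) := by
  constructor
  · intro h
    have hx := S14.main_rat h
    have hy : y ^ 2 = 1 := by
      rw [h]; linear_combination (x ^ 4 + 2 * x ^ 2 + 2) * hx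
    exact ⟨by simpa using hx, by simpa using hy⟩
  · rintro ⟨rfl | rfl, rfl | rfl⟩ <;> norm_num
end

section
/- The only rational affine points on the curve y^2 = x^6 - 2x^4 + 3x^2 - 1 are (x, y) = (±1, ±1). -/
/-- The ring of Eisenstein integers. -/
abbrev Eis : Type := QuadraticAlgebra ℤ (-1) (-1)

namespace Eis

open QuadraticAlgebra

theorem norm_eq (z : Eis) : z.norm = z.re ^ 2 - z.re * z.im + z.im ^ 2 := by
  rw [norm_def]; ring

theorem norm_nonneg (z : Eis) : 0 ≤ z.norm := by
  rw [norm_eq]; nlinarith [sq_nonneg (2 * z.re - z.im), sq_nonneg z.im]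

theorem norm_pos {z : Eis} (hz : z ≠ 0) : 0 < z.norm := by
  rcases (norm_nonneg z).lt_or_eq with h | h
  · exact h
  · exfalso
    apply hz
    rw [norm_eq] at h
    have h2 : z.im = 0 := by
      apply pow_eq_zero_iff (two_ne_zero) |>.1
      nlinarith [sq_nonneg (2 * z.re - z.im), sq_nonneg z.im]
    have h1 : z.re = 0 := by
      apply pow_eq_zero_iff (two_ne_zero) |>.1
      rw [h2] at h; linarith
    ext <;> simp [h1, h2]

/-- Quotient by rounding coordinates. -/
def quo (x y : Eis) : Eis :=
  ⟨(2 * (x * star y).re + y.norm) / (2 * y.norm), (2 * (x * star y).im + y.norm) / (2 * y.norm)⟩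

theorem round_bd (a n : ℤ) (hn : 0 < n) :
    |2 * (a - n * ((2 * a + n) / (2 * n)))| ≤ n := by
  have h1 := Int.emod_add_mul_ediv (2 * a + n) (2 * n)
  have h2 := Int.emod_nonneg (2 * a + n) (b := 2 * n) (by omega)
  have h3 := Int.emod_lt_of_pos (2 * a + n) (b := 2 * n) (by omega)
  rw [abs_le]
  constructor <;> nlinarith

theorem norm_rem_lt (x : Eis) {y : Eis} (hy : y ≠ 0) : (x - y * quo x y).norm < y.norm := by
  have hn := norm_pos hy
  have e : (x - y * quo x y).norm * y.norm = (x * star y - (y.norm : Eis) * quo x y).norm := by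
    have : (y.norm : Eis) = y * star y := by
      rw [← algebraMap_norm_eq_mul_star]; rfl
    rw [this, ← norm_star y, ← map_mul]; congr 1; ring
  have b1 := abs_le.1 (round_bd (x * star y).re y.norm hn)
  have b2 := abs_le.1 (round_bd (x * star y).im y.norm hn)
  set r := (x * star y - (y.norm : Eis) * quo x y) with hr
  have r1 : r.re = (x * star y).re - y.norm * ((2 * (x * star y).re + y.norm) / (2 * y.norm)) := by
    rw [hr, re_sub, re_mul (y.norm : Eis), re_intCast, im_intCast]; simp [quo]
  have r2 : r.im = (x * star y).im - y.norm * ((2 * (x * star y).im + y.norm) / (2 * y.norm)) := by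
    rw [hr, im_sub, im_mul (y.norm : Eis), re_intCast, im_intCast]; simp [quo]
  rw [← r1] at b1
  rw [← r2] at b2
  have : r.norm < y.norm * y.norm := by
    rw [norm_eq r]
    generalize y.norm = n at *
    generalize r.re = s at *
    generalize r.im = t at *
    have hs : 4 * s ^ 2 ≤ n ^ 2 := by nlinarith
    have ht : 4 * t ^ 2 ≤ n ^ 2 := by nlinarith
    nlinarith [sq_nonneg (s + t)]
  rw [← e] at this
  exact lt_of_mul_lt_mul_right this hn.le

instance instEuclid : EuclideanDomain Eis :=
  { (inferInstance : CommRing Eis), (inferInstance : Nontrivial Eis) with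
    quotient := quo
    remainder := fun x y => x - y * quo x y
    quotient_zero := by intro a; ext <;> simp [quo]
    quotient_mul_add_remainder_eq := by intro a b; ring
    r := fun a b => a.norm.natAbs < b.norm.natAbs
    r_wellFounded := (measure (fun a : Eis => a.norm.natAbs)).wf
    remainder_lt := by
      intro a b hb
      have := norm_rem_lt a hb
      have h0 := norm_nonneg (a - b * quo a b)
      zify
      rw [abs_of_nonneg h0, abs_of_nonneg (norm_nonneg b)]
      exact this
    mul_left_not_lt := by
      intro a b hb
      have h1 := norm_pos hb
      rw [not_lt, map_mul, Int.natAbs_mul]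
      exact Nat.le_mul_of_pos_right _ (by omega) }

theorem unit_cases (z : Eis) (h : z.norm = 1) :
    ∃ s : ℤ, (s = 1 ∨ s = -1) ∧ (z = ⟨s, 0⟩ ∨ z = ⟨0, s⟩ ∨ z = ⟨s, s⟩) := by
  rw [norm_eq] at h
  obtain ⟨a, b⟩ := z
  simp only at h
  have ha : a ≤ 1 := by nlinarith [sq_nonneg (2 * b - a)]
  have ha' : -1 ≤ a := by nlinarith [sq_nonneg (2 * b - a)]
  have hb : b ≤ 1 := by nlinarith [sq_nonneg (2 * a - b)]
  have hb' : -1 ≤ b := by nlinarith [sq_nonneg (2 * a - b)]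
  interval_cases a <;> interval_cases b <;> simp_all

theorem cube_of_coprime {a b n : ℤ} (hab : IsCoprime a b) (ha : ¬ (3 : ℤ) ∣ a) (hb : (3 : ℤ) ∣ b)
    (h : a ^ 2 - a * b + b ^ 2 = n ^ 3) :
    ∃ e f : ℤ, a = e ^ 3 + f ^ 3 - 3 * e * f ^ 2 ∧ b = 3 * e * f * (e - f) := by
  have hN3 : IsCoprime (a ^ 2 - a * b + b ^ 2) (3 * b) := by
    obtain ⟨k, rfl⟩ := hb
    have h3a : IsCoprime a 3 := by
      rw [isCoprime_comm]
      exact (Prime.coprime_iff_not_dvd Int.prime_three).2 ha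
    have h1 : IsCoprime (a ^ 2 - a * (3 * k) + (3 * k) ^ 2) (3 * k) := by
      have : a ^ 2 - a * (3 * k) + (3 * k) ^ 2 = a ^ 2 + (3 * k) * (3 * k - a) := by ring
      rw [this, IsCoprime.add_mul_left_left_iff]
      exact hab.pow_left
    have h2 : IsCoprime (a ^ 2 - a * (3 * k) + (3 * k) ^ 2) 3 := by
      have : a ^ 2 - a * (3 * k) + (3 * k) ^ 2 = a ^ 2 + 3 * (3 * k ^ 2 - a * k) := by ring
      rw [this, IsCoprime.add_mul_left_left_iff]
      exact h3a.pow_left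
    exact h2.mul_right h1
  let g : Eis := ⟨a, b⟩
  let g' : Eis := ⟨a - b, -b⟩
  have hgg : g * g' = ((a ^ 2 - a * b + b ^ 2 : ℤ) : Eis) := by
    ext
    · rw [re_mul, re_intCast]; simp [g, g']; ring
    · rw [im_mul, im_intCast]; simp [g, g']; ring
  have hdiff : ((3 * b : ℤ) : Eis) = (g - g') * ⟨-1, -2⟩ := by
    ext
    · rw [re_mul, re_intCast]; simp [g, g']; ring
    · rw [im_mul, im_intCast]; simp [g, g']; ring
  have hcop : IsCoprime g g' := by
    obtain ⟨u, v, huv⟩ := hN3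
    have huv' : (u : Eis) * (g * g') + (v : Eis) * ((g - g') * ⟨-1, -2⟩) = 1 := by
      rw [hgg, ← hdiff]; exact_mod_cast congrArg (Int.cast : ℤ → Eis) huv
    refine ⟨(u : Eis) * g' + (v : Eis) * ⟨-1, -2⟩, - (v : Eis) * ⟨-1, -2⟩, ?_⟩
    rw [← huv']; ring
  have hpow : g * g' = (n : Eis) ^ 3 := by
    rw [hgg, h]; push_cast; rfl
  obtain ⟨d, w, hw⟩ := exists_associated_pow_of_mul_eq_pow' hcop hpow
  have hwn : (w : Eis).norm = 1 := by
    have h1 : IsUnit (w : Eis).norm := isUnit_iff_norm_isUnit.1 w.isUnit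
    rcases Int.isUnit_iff.1 h1 with h2 | h2
    · exact h2
    · have := norm_nonneg (w : Eis); omega
  obtain ⟨s, hs, hz⟩ := unit_cases _ hwn
  obtain ⟨e, f⟩ := d
  have hd3 : (⟨e, f⟩ : Eis) ^ 3 = ⟨e ^ 3 + f ^ 3 - 3 * e * f ^ 2, 3 * e * f * (e - f)⟩ := by
    rw [pow_succ, pow_two]
    ext
    · simp; ring
    · simp; ring
  rw [hd3] at hw
  obtain ⟨b, rfl⟩ := hb
  rcases hz with hz | hz | hz
  · rw [hz] at hw
    have h1 := congrArg re hw
    have h2 := congrArg im hw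
    simp [g] at h1 h2
    rcases hs with rfl | rfl
    · exact ⟨e, f, by linarith, by linarith⟩
    · exact ⟨-e, -f, by linarith, by linarith⟩
  · exfalso
    rw [hz] at hw
    have h1 := congrArg re hw
    have h2 := congrArg im hw
    simp [g] at h1 h2
    apply ha
    rcases hs with rfl | rfl
    · exact ⟨- (e * f * (e - f)), by linarith⟩
    · exact ⟨(e * f * (e - f)), by linarith⟩
  · exfalso
    rw [hz] at hw
    have h1 := congrArg re hw
    have h2 := congrArg im hw
    simp [g] at h1 h2
    apply ha
    rcases hs with rfl | rfl
    · exact ⟨b - e * f * (e - f), by linarith⟩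
    · exact ⟨b + (e * f * (e - f)), by linarith⟩

end Eis

theorem cop_of_prime {a b : ℤ} (h : ∀ p : ℤ, Prime p → p ∣ a → p ∣ b → False) : IsCoprime a b := by
  apply isCoprime_of_prime_dvd
  · rintro ⟨rfl, rfl⟩
    exact h 2 Int.prime_two (dvd_zero _) (dvd_zero _)
  · intro p hp h1 h2
    exact h p hp h1 h2

theorem prime_no {p X Y : ℤ} (hp : Prime p) (h : IsCoprime X Y) (hx : p ∣ X) (hy : p ∣ Y) : False :=
  hp.not_isUnit (h.isUnit_of_dvd' hx hy)

theorem prime_eq_of_dvd {p q : ℤ} (hp : Prime p) (hq : Prime q) (h : p ∣ q) : q ∣ p :=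
  (hp.associated_of_dvd hq h).symm.dvd

theorem inert2 {a b : ℤ} (h : (2 : ℤ) ∣ a ^ 2 - a * b + b ^ 2) : (2 : ℤ) ∣ a ∧ (2 : ℤ) ∣ b := by
  have key : ∀ a b : ZMod 2, a ^ 2 - a * b + b ^ 2 = 0 → a = 0 ∧ b = 0 := by decide
  have h' := (ZMod.intCast_zmod_eq_zero_iff_dvd (a ^ 2 - a * b + b ^ 2) 2).2 h
  push_cast at h'
  obtain ⟨h1, h2⟩ := key _ _ h'
  exact ⟨(ZMod.intCast_zmod_eq_zero_iff_dvd a 2).1 h1, (ZMod.intCast_zmod_eq_zero_iff_dvd b 2).1 h2⟩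

theorem inert23 {a b : ℤ} (h : (23 : ℤ) ∣ a ^ 2 - a * b + b ^ 2) :
    (23 : ℤ) ∣ a ∧ (23 : ℤ) ∣ b := by
  have key : ∀ a b : ZMod 23, a ^ 2 - a * b + b ^ 2 = 0 → a = 0 ∧ b = 0 := by decide
  have h' := (ZMod.intCast_zmod_eq_zero_iff_dvd (a ^ 2 - a * b + b ^ 2) 23).2 h
  push_cast at h'
  obtain ⟨h1, h2⟩ := key _ _ h'
  exact ⟨(ZMod.intCast_zmod_eq_zero_iff_dvd a 23).1 h1,
    (ZMod.intCast_zmod_eq_zero_iff_dvd b 23).1 h2⟩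

theorem prime23 : Prime (23 : ℤ) := by
  rw [Int.prime_iff_natAbs_prime]; norm_num

theorem pow3_inj {a b : ℤ} (h : a ^ 3 = b ^ 3) : a = b :=
  (Odd.strictMono_pow (by decide : Odd 3)).injective h

/-- The rational factor is divisible by 46. -/
theorem dvd46 {X Y Z : ℤ} (hc : IsCoprime X Y) (h : X ^ 3 + Y ^ 3 + 2 * Z ^ 3 = 2 * X * Y * Z) :
    ∃ l : ℤ, 3 * X + 3 * Y + 2 * Z = -46 * l ∧
      l * ((2 * Z - 3 * Y) ^ 2 - (2 * Z - 3 * Y) * (3 * (X - Y)) + (3 * (X - Y)) ^ 2) = Z ^ 3 := by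
  set N := (2 * Z - 3 * Y) ^ 2 - (2 * Z - 3 * Y) * (3 * (X - Y)) + (3 * (X - Y)) ^ 2 with hN
  have hLN : (3 * X + 3 * Y + 2 * Z) * N = -46 * Z ^ 3 := by
    rw [hN]; linear_combination 27 * h
  have h2 : (2 : ℤ) ∣ 3 * X + 3 * Y + 2 * Z := by
    have : (2 : ℤ) ∣ (3 * X + 3 * Y + 2 * Z) * N := ⟨-23 * Z ^ 3, by rw [hLN]; ring⟩
    rcases Int.prime_two.dvd_or_dvd this with h1 | h1
    · exact h1
    · exfalso
      obtain ⟨h3, h4⟩ := inert2 h1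
      exact prime_no Int.prime_two hc (by omega) (by omega)
  have h23 : (23 : ℤ) ∣ 3 * X + 3 * Y + 2 * Z := by
    have : (23 : ℤ) ∣ (3 * X + 3 * Y + 2 * Z) * N := ⟨-2 * Z ^ 3, by rw [hLN]; ring⟩
    rcases prime23.dvd_or_dvd this with h1 | h1
    · exact h1
    · exfalso
      obtain ⟨⟨s, h3⟩, ⟨t, h4⟩⟩ := inert23 h1
      have h5 : (23 : ℤ) ∣ Z := by
        have h6 : (23 : ℤ) ∣ 2 * Z ^ 3 := by
          refine ⟨- (3 * X + 3 * Y + 2 * Z) * (s ^ 2 - s * t + t ^ 2), ?_⟩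
          rw [hN, h3, h4] at hLN
          linarith
        rcases prime23.dvd_or_dvd h6 with h7 | h7
        · norm_num at h7
        · exact prime23.dvd_of_dvd_pow h7
      exact prime_no prime23 hc (by omega) (by omega)
  have h46 : (46 : ℤ) ∣ 3 * X + 3 * Y + 2 * Z := by omega
  obtain ⟨k, hk⟩ := h46
  refine ⟨-k, by linarith, ?_⟩
  rw [hk] at hLN
  linarith

/-- First half of the descent: extraction of a cube in the Eisenstein integers. -/
theorem extract {X Y Z : ℤ} (hc : IsCoprime X Y)
    (h : X ^ 3 + Y ^ 3 + 2 * Z ^ 3 = 2 * X * Y * Z) :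
    ∃ e f c : ℤ, 2 * Z - 3 * Y = e ^ 3 + f ^ 3 - 3 * e * f ^ 2 ∧
      3 * (X - Y) = 3 * e * f * (e - f) ∧ 3 * X + 3 * Y + 2 * Z = -46 * c ^ 3 ∧
      Z = c * (e ^ 2 - e * f + f ^ 2) := by
  obtain ⟨l, hl, hlN⟩ := dvd46 hc h
  suffices hs : ∃ e f : ℤ, 2 * Z - 3 * Y = e ^ 3 + f ^ 3 - 3 * e * f ^ 2 ∧
      3 * (X - Y) = 3 * e * f * (e - f) by
    obtain ⟨e, f, h1, h2⟩ := hs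
    have hN : (2 * Z - 3 * Y) ^ 2 - (2 * Z - 3 * Y) * (3 * (X - Y)) + (3 * (X - Y)) ^ 2
        = (e ^ 2 - e * f + f ^ 2) ^ 3 := by
      rw [h1, h2]; ring
    have hn0 : e ^ 2 - e * f + f ^ 2 ≠ 0 := by
      intro h0
      rw [h0] at hN
      obtain ⟨h3, h4⟩ := inert2 (hN ▸ (by norm_num) :
        (2 : ℤ) ∣ (2 * Z - 3 * Y) ^ 2 - (2 * Z - 3 * Y) * (3 * (X - Y)) + (3 * (X - Y)) ^ 2)
      exact prime_no Int.prime_two hc (by omega) (by omega)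
    rw [hN] at hlN
    have hd : e ^ 2 - e * f + f ^ 2 ∣ Z := by
      rw [← Int.pow_dvd_pow_iff (n := 3) (by norm_num)]
      exact ⟨l, by rw [← hlN]; ring⟩
    obtain ⟨c, hcz⟩ := hd
    refine ⟨e, f, c, h1, h2, ?_, by rw [hcz]; ring⟩
    rw [hl]
    congr 1
    apply mul_right_cancel₀ (pow_ne_zero 3 hn0)
    rw [hlN, hcz]; ring
  -- coprimality away from 3
  have hcopl : ∀ p : ℤ, Prime p → ¬ p ∣ 3 → p ∣ l → p ∣ (2 * Z - 3 * Y) ^ 2 -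
      (2 * Z - 3 * Y) * (3 * (X - Y)) + (3 * (X - Y)) ^ 2 → False := by
    intro p hp hp3 h1 h2
    have hz : p ∣ Z := by
      apply hp.dvd_of_dvd_pow (n := 3)
      rw [← hlN]; exact Dvd.dvd.mul_right h1 _
    have hL : p ∣ 3 * X + 3 * Y + 2 * Z := by rw [hl]; exact Dvd.dvd.mul_left h1 _
    have h4 : p ∣ X + Y := by
      have : p ∣ 3 * (X + Y) := by
        have e1 : 3 * (X + Y) = (3 * X + 3 * Y + 2 * Z) - 2 * Z := by ring
        rw [e1]
        exact dvd_sub hL (Dvd.dvd.mul_left hz 2)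
      exact (hp.dvd_or_dvd this).resolve_left hp3
    have h5 : p ∣ 3 * (3 * (3 * (X * Y))) := by
      have e1 : 3 * (3 * (3 * (X * Y))) = (3 * X + 3 * Y + 2 * Z) * (3 * X + 3 * Y + 2 * Z)
        - ((2 * Z - 3 * Y) ^ 2 - (2 * Z - 3 * Y) * (3 * (X - Y)) + (3 * (X - Y)) ^ 2)
        - 18 * (X + Y) * Z := by ring
      rw [e1]
      exact dvd_sub (dvd_sub (Dvd.dvd.mul_left hL _) h2) (Dvd.dvd.mul_left hz _)
    have h6 := (hp.dvd_or_dvd h5).resolve_left hp3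
    have h7 := (hp.dvd_or_dvd h6).resolve_left hp3
    have h8 := (hp.dvd_or_dvd h7).resolve_left hp3
    rcases hp.dvd_or_dvd h8 with h9 | h9
    · exact prime_no hp hc h9 ((dvd_add_right h9).1 h4)
    · exact prime_no hp hc ((dvd_add_left h9).1 h4) h9
  have hfin : ∀ p : ℤ, Prime p → ¬ p ∣ 3 → p ∣ Z → p ∣ 2 * Z - 3 * Y → p ∣ 3 * (X - Y) → False := by
    intro p hp hp3 h1 h2 h3
    have hy : p ∣ Y := by
      have : p ∣ 3 * Y := by
        have e1 : 3 * Y = 2 * Z - (2 * Z - 3 * Y) := by ring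
        rw [e1]
        exact dvd_sub (Dvd.dvd.mul_left h1 2) h2
      exact (hp.dvd_or_dvd this).resolve_left hp3
    have hx := (hp.dvd_or_dvd h3).resolve_left hp3
    exact prime_no hp hc ((dvd_sub_left hy).1 hx) hy
  have h3odd : Odd 3 := by decide
  by_cases h3 : (3 : ℤ) ∣ Z
  · have hXY : ¬ ((3 : ℤ) ∣ X * Y) ∧ (3 : ℤ) ∣ X + Y := by
      have h4 : (3 : ℤ) ∣ X + Y := by
        obtain ⟨z, rfl⟩ := h3
        apply Int.prime_three.dvd_of_dvd_pow (n := 3)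
        exact ⟨2 * X * Y * z - 18 * z ^ 3 + X * Y * (X + Y), by linear_combination h⟩
      refine ⟨?_, h4⟩
      intro h5
      rcases Int.prime_three.dvd_or_dvd h5 with h9 | h9
      · exact prime_no Int.prime_three hc h9 ((dvd_add_right h9).1 h4)
      · exact prime_no Int.prime_three hc ((dvd_add_left h9).1 h4) h9
    obtain ⟨hXY, k, hk⟩ := hXY
    obtain ⟨z, hz⟩ := h3
    have hX : X = 3 * k - Y := by linarith
    have h9z : (3 : ℤ) ∣ z := by
      have : (3 : ℤ) ∣ X * Y * (2 * z) := by
        refine ⟨3 * k ^ 3 - X * Y * k + 6 * z ^ 3, ?_⟩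
        have e1 : 3 * (X * Y * (2 * z)) = 3 * (3 * (3 * k ^ 3 - X * Y * k + 6 * z ^ 3)) := by
          rw [hz, hX] at h
          rw [hX]
          linear_combination -h
        linarith
      have := (Int.prime_three.dvd_or_dvd this).resolve_left hXY
      omega
    obtain ⟨w, rfl⟩ := h9z
    have hkw : (3 : ℤ) ∣ k + 2 * w := by
      have : (3 : ℤ) ∣ X * Y * (k + 2 * w) := by
        refine ⟨k ^ 3 + 54 * w ^ 3, ?_⟩
        have e1 : 9 * (X * Y * (k + 2 * w)) = 9 * (3 * (k ^ 3 + 54 * w ^ 3)) := by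
          rw [hz, hX] at h
          rw [hX]
          linear_combination -h
        linarith
      exact (Int.prime_three.dvd_or_dvd this).resolve_left hXY
    have h3Y : ¬ (3 : ℤ) ∣ Y := fun hy => hXY (Dvd.dvd.mul_left hy _)
    -- δ = a + b ω
    obtain ⟨a, ha⟩ : ∃ a, a = -Y - 2 * w + 2 * k := ⟨_, rfl⟩
    obtain ⟨b, hb⟩ : ∃ b, b = k - 4 * w := ⟨_, rfl⟩
    have g1 : 2 * Z - 3 * Y = 3 * (a - 2 * b) := by rw [hz, ha, hb]; ring
    have g2 : 3 * (X - Y) = 3 * (2 * a - b) := by rw [hX, ha, hb]; ring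
    have hNd : (2 * Z - 3 * Y) ^ 2 - (2 * Z - 3 * Y) * (3 * (X - Y)) + (3 * (X - Y)) ^ 2
      = 27 * (a ^ 2 - a * b + b ^ 2) := by rw [g1, g2]; ring
    have hb3 : (3 : ℤ) ∣ b := by omega
    have ha3 : ¬ (3 : ℤ) ∣ a := by omega
    have hn3 : ¬ (3 : ℤ) ∣ a ^ 2 - a * b + b ^ 2 := by
      intro h4
      apply ha3
      apply Int.prime_three.dvd_of_dvd_pow (n := 2)
      have : a ^ 2 = (a ^ 2 - a * b + b ^ 2) + b * (a - b) := by ring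
      rw [this]
      exact dvd_add h4 (Dvd.dvd.mul_right hb3 _)
    have hlw : l * (a ^ 2 - a * b + b ^ 2) = (3 * w) ^ 3 := by
      rw [hNd, hz] at hlN
      linarith
    have hp3 : ∀ p : ℤ, Prime p → p ∣ a ^ 2 - a * b + b ^ 2 → ¬ p ∣ 3 := by
      intro p hp h4 h5
      exact hn3 ((prime_eq_of_dvd hp Int.prime_three h5).trans h4)
    have hcop1 : IsCoprime l (a ^ 2 - a * b + b ^ 2) := by
      apply cop_of_prime
      intro p hp h4 h5
      apply hcopl p hp (hp3 p hp h5) h4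
      rw [hNd]; exact Dvd.dvd.mul_left h5 _
    obtain ⟨n, hn⟩ := Int.eq_pow_of_mul_eq_pow_odd_right hcop1 h3odd hlw
    have hcop2 : IsCoprime a b := by
      apply cop_of_prime
      intro p hp h4 h5
      have h6 : p ∣ a ^ 2 - a * b + b ^ 2 := by
        obtain ⟨a, rfl⟩ := h4
        obtain ⟨b, rfl⟩ := h5
        exact ⟨p * (a ^ 2 - a * b + b ^ 2), by ring⟩
      have h7 : p ∣ Z := by
        have h8 : p ∣ 3 * w := hp.dvd_of_dvd_pow (n := 3) (hlw ▸ Dvd.dvd.mul_left h6 _)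
        rw [hz]; exact Dvd.dvd.mul_left h8 _
      apply hfin p hp (hp3 p hp h6) h7
      · rw [g1]; exact Dvd.dvd.mul_left (dvd_sub h4 (Dvd.dvd.mul_left h5 _)) _
      · rw [g2]; exact Dvd.dvd.mul_left (dvd_sub (Dvd.dvd.mul_left h4 _) h5) _
    obtain ⟨e, f, he, hf⟩ := Eis.cube_of_coprime hcop2 ha3 hb3 hn
    -- multiply by -(1 - ω)
    refine ⟨-(e + f), e - 2 * f, ?_, ?_⟩
    · rw [g1, he, hf]; ring
    · rw [g2, he, hf]; ring
  · have hb3 : (3 : ℤ) ∣ 3 * (X - Y) := ⟨_, rfl⟩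
    have ha3 : ¬ (3 : ℤ) ∣ 2 * Z - 3 * Y := by omega
    have hn3 : ∀ p : ℤ, Prime p → p ∣ Z → ¬ p ∣ 3 := by
      intro p hp h4 h5
      exact h3 ((prime_eq_of_dvd hp Int.prime_three h5).trans h4)
    have hcop1 : IsCoprime l ((2 * Z - 3 * Y) ^ 2 -
      (2 * Z - 3 * Y) * (3 * (X - Y)) + (3 * (X - Y)) ^ 2) := by
      apply cop_of_prime
      intro p hp h4 h5
      refine hcopl p hp (hn3 p hp ?_) h4 h5
      apply hp.dvd_of_dvd_pow (n := 3)
      rw [← hlN]; exact Dvd.dvd.mul_right h4 _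
    obtain ⟨n, hn⟩ := Int.eq_pow_of_mul_eq_pow_odd_right hcop1 h3odd hlN
    have hcop2 : IsCoprime (2 * Z - 3 * Y) (3 * (X - Y)) := by
      apply cop_of_prime
      intro p hp h4 h5
      have h7 : p ∣ Z := by
        apply hp.dvd_of_dvd_pow (n := 3)
        rw [← hlN]
        apply Dvd.dvd.mul_left
        have e1 : (2 * Z - 3 * Y) ^ 2 - (2 * Z - 3 * Y) * (3 * (X - Y)) + (3 * (X - Y)) ^ 2 =
          (2 * Z - 3 * Y) * (2 * Z - 3 * Y - 3 * (X - Y)) + (3 * (X - Y)) * (3 * (X - Y)) := by ring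
        rw [e1]
        exact dvd_add (Dvd.dvd.mul_right h4 _) (Dvd.dvd.mul_right h5 _)
      exact hfin p hp (hn3 p hp h7) h7 h4 h5
    exact Eis.cube_of_coprime hcop2 ha3 hb3 hn

/-- Pairwise coprime integers whose product is twice a cube. -/
theorem three_cubes {P Q R c : ℤ} (h12 : IsCoprime P Q) (h13 : IsCoprime P R) (h23 : IsCoprime Q R)
    (hR : (2 : ℤ) ∣ R) (hp : P * Q * R = -2 * c ^ 3) (hs : P + Q + R = -2 * c) :
    ∃ A B C : ℤ, IsCoprime A B ∧ A ^ 3 + B ^ 3 + 2 * C ^ 3 = 2 * A * B * C ∧ c = - (A * B * C) := by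
  obtain ⟨S, rfl⟩ := hR
  have h13' : IsCoprime P S := h13.of_mul_right_right
  have h23' : IsCoprime Q S := h23.of_mul_right_right
  have h3odd : Odd 3 := by decide
  have hprod : P * Q * S = (-c) ^ 3 := by linarith [hp, (by ring : (-c) ^ 3 = - c ^ 3)]
  have hPQS : IsCoprime (P * Q) S := h13'.mul_left h23'
  obtain ⟨⟨D, hD⟩, ⟨C, hC⟩⟩ := Int.eq_pow_of_mul_eq_pow_odd hPQS h3odd hprod
  obtain ⟨⟨A, hA⟩, ⟨B, hB⟩⟩ := Int.eq_pow_of_mul_eq_pow_odd h12 h3odd hD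
  subst hA hB hC
  have hc : c = - (A * B * C) := by
    apply pow3_inj
    linear_combination hprod
  refine ⟨A, B, C, ?_, ?_, hc⟩
  · exact (IsCoprime.pow_iff (by norm_num) (by norm_num)).1 h12
  · rw [hc] at hs; linarith

theorem pair_dvd {p P Q R c : ℤ} (hp : Prime p) (h1 : p ∣ P) (h2 : p ∣ Q)
    (hprod : P * Q * R = -2 * c ^ 3) (hsum : P + Q + R = -2 * c) : p ∣ c ∧ p ∣ R := by
  have hc : p ∣ c := by
    apply hp.dvd_of_dvd_pow (n := 3)
    by_cases h22 : p ∣ 2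
    · obtain ⟨m, hm⟩ := prime_eq_of_dvd hp Int.prime_two h22
      obtain ⟨a, rfl⟩ := h1
      obtain ⟨b, rfl⟩ := h2
      refine ⟨- (m * a * b * R), ?_⟩
      have e2 : p * a * (2 * m * b) * R = -2 * c ^ 3 := by rw [← hm]; exact hprod
      linarith
    · have : p ∣ 2 * c ^ 3 := by
        have e1 : 2 * c ^ 3 = P * (- (Q * R)) := by linarith
        rw [e1]; exact Dvd.dvd.mul_right h1 _
      exact (hp.dvd_or_dvd this).resolve_left h22
  refine ⟨hc, ?_⟩
  have e1 : R = -2 * c - P - Q := by linarith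
  rw [e1]
  exact dvd_sub (dvd_sub (Dvd.dvd.mul_left hc _) h1) h2

theorem descent_step {X Y Z : ℤ} (hc : IsCoprime X Y) (hZ : Z ≠ 0)
    (h : X ^ 3 + Y ^ 3 + 2 * Z ^ 3 = 2 * X * Y * Z) :
    ∃ A B C : ℤ, IsCoprime A B ∧ A ^ 3 + B ^ 3 + 2 * C ^ 3 = 2 * A * B * C ∧ C ≠ 0 ∧
      C.natAbs < Z.natAbs := by
  suffices hs : ∃ A B C n : ℤ, IsCoprime A B ∧ A ^ 3 + B ^ 3 + 2 * C ^ 3 = 2 * A * B * C ∧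
      Z = C * (A * B * n) by
    obtain ⟨A, B, C, n, h1, h2, h3⟩ := hs
    have hC : C ≠ 0 := by rintro rfl; simp at h3; exact hZ h3
    refine ⟨A, B, C, h1, h2, hC, ?_⟩
    have hABn : A * B * n ≠ 0 := by intro h0; rw [h0] at h3; simp at h3; exact hZ h3
    have hne : (A * B * n).natAbs ≠ 1 := by
      intro h4
      have h5 : IsUnit (A * B * n) := Int.isUnit_iff_natAbs_eq.2 h4
      have hAB := isUnit_of_mul_isUnit_left h5
      have hA := Int.isUnit_iff.1 (isUnit_of_mul_isUnit_left hAB)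
      have hB := Int.isUnit_iff.1 (isUnit_of_mul_isUnit_right hAB)
      have key1 : C ^ 3 + C = C * (C ^ 2 + 1) := by ring
      have h0 : ∀ C : ℤ, C ^ 3 - C = -1 ∨ C ^ 3 - C = 1 → False := by
        intro C hC
        have : (2 : ℤ) ∣ C ^ 3 - C := by
          have e : C ^ 3 - C = (C * (C + 1)) * (C - 1) := by ring
          rw [e]
          exact Dvd.dvd.mul_right (Int.even_mul_succ_self C).two_dvd _
        omega
      have h0' : C * (C ^ 2 + 1) ≠ 0 := mul_ne_zero hC (by positivity)
      rcases hA with rfl | rfl <;> rcases hB with rfl | rfl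
      · exact h0 C (Or.inl (by linarith))
      · exact h0' (by linarith)
      · exact h0' (by linarith)
      · exact h0 C (Or.inr (by linarith))
    rw [h3, Int.natAbs_mul]
    have h6 : 1 < (A * B * n).natAbs := by omega
    have h7 : 0 < C.natAbs := by omega
    nlinarith
  obtain ⟨e, f, c, h1, h2, h3, h4⟩ := extract hc h
  -- the equation of the second curve
  have hE : 6 * (c * (e ^ 2 - e * f + f ^ 2)) = -46 * c ^ 3 + (e + f) * (2 * e - f) * (e - 2 * f) := by
    linear_combination h3 - 6 * h4 + 2 * h1 - h2
  have hU : (e + f - 2 * c) * (e - 2 * f - 2 * c) * (f - 2 * e - 2 * c) = -54 * c ^ 3 := by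
    linear_combination hE
  have h3U : (3 : ℤ) ∣ e + f - 2 * c := by
    have : (3 : ℤ) ∣ (e + f - 2 * c) * (e - 2 * f - 2 * c) * (f - 2 * e - 2 * c) :=
      ⟨-18 * c ^ 3, by rw [hU]; ring⟩
    rcases Int.prime_three.dvd_or_dvd this with h5 | h5
    · rcases Int.prime_three.dvd_or_dvd h5 with h6 | h6 <;> omega
    · omega
  obtain ⟨P, hP⟩ := h3U
  obtain ⟨Q, hQ⟩ : ∃ Q, Q = P - f := ⟨_, rfl⟩
  obtain ⟨R, hR⟩ : ∃ R, R = P - e := ⟨_, rfl⟩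
  have hQ' : e - 2 * f - 2 * c = 3 * Q := by omega
  have hR' : f - 2 * e - 2 * c = 3 * R := by omega
  have hsum : P + Q + R = -2 * c := by omega
  have hprod : P * Q * R = -2 * c ^ 3 := by
    rw [hP, hQ', hR'] at hU
    linarith
  have hall : ∀ p : ℤ, Prime p → p ∣ P → p ∣ Q → p ∣ R → p ∣ c → False := by
    intro p hp hp1 hp2 hp3 hpc
    have hf : p ∣ f := by
      have : f = P - Q := by omega
      rw [this]; exact dvd_sub hp1 hp2
    have he : p ∣ e := by
      have : e = P - R := by omega
      rw [this]; exact dvd_sub hp1 hp3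
    have hXY : p ∣ X - Y := by
      have : X - Y = e * (f * (e - f)) := by linarith
      rw [this]; exact Dvd.dvd.mul_right he _
    have hY : p ∣ Y := by
      obtain ⟨e, rfl⟩ := he
      obtain ⟨f, rfl⟩ := hf
      obtain ⟨c, rfl⟩ := hpc
      by_cases h33 : p ∣ 3
      · -- p is 3 up to sign; use divisibility by p ^ 3
        obtain ⟨m, hm⟩ := prime_eq_of_dvd hp Int.prime_three h33
        refine ⟨m * p * (2 * c * (e ^ 2 - e * f + f ^ 2) - (e ^ 3 + f ^ 3 - 3 * e * f ^ 2)), ?_⟩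
        have e1 : 3 * Y = p ^ 2 * p *
            (2 * c * (e ^ 2 - e * f + f ^ 2) - (e ^ 3 + f ^ 3 - 3 * e * f ^ 2)) := by
          linear_combination 2 * h4 - h1
        have e2 : 3 * Y = p ^ 2 * (3 * m) *
            (2 * c * (e ^ 2 - e * f + f ^ 2) - (e ^ 3 + f ^ 3 - 3 * e * f ^ 2)) := by
          rw [e1, ← hm]
        linarith
      · have : p ∣ 3 * Y := by
          refine ⟨2 * c * p ^ 2 * (e ^ 2 - e * f + f ^ 2) - p ^ 2 * (e ^ 3 + f ^ 3 - 3 * e * f ^ 2), ?_⟩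
          linear_combination 2 * h4 - h1
        exact (hp.dvd_or_dvd this).resolve_left h33
    exact prime_no hp hc ((dvd_sub_left hY).1 hXY) hY
  have h12 : IsCoprime P Q := by
    apply cop_of_prime
    intro p hp hp1 hp2
    obtain ⟨hpc, hpr⟩ := pair_dvd hp hp1 hp2 hprod hsum
    exact hall p hp hp1 hp2 hpr hpc
  have h13 : IsCoprime P R := by
    apply cop_of_prime
    intro p hp hp1 hp2
    obtain ⟨hpc, hpr⟩ := pair_dvd (R := Q) (c := c) hp hp1 hp2 (by linarith) (by linarith)
    exact hall p hp hp1 hpr hp2 hpc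
  have h23 : IsCoprime Q R := by
    apply cop_of_prime
    intro p hp hp1 hp2
    obtain ⟨hpc, hpr⟩ := pair_dvd (R := P) (c := c) hp hp1 hp2 (by linarith) (by linarith)
    exact hall p hp hpr hp1 hp2 hpc
  have h2 : (2 : ℤ) ∣ P * Q * R := ⟨-c ^ 3, by rw [hprod]; ring⟩
  suffices hs : ∃ A B C : ℤ, IsCoprime A B ∧ A ^ 3 + B ^ 3 + 2 * C ^ 3 = 2 * A * B * C ∧
      c = - (A * B * C) by
    obtain ⟨A, B, C, g1, g2, g3⟩ := hs
    refine ⟨A, B, C, - (e ^ 2 - e * f + f ^ 2), g1, g2, ?_⟩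
    rw [h4, g3]; ring
  rcases Int.prime_two.dvd_or_dvd h2 with h5 | h5
  · rcases Int.prime_two.dvd_or_dvd h5 with h6 | h6
    · exact three_cubes h23 h12.symm h13.symm h6 (by linarith) (by linarith)
    · exact three_cubes h13 h12 h23.symm h6 (by linarith) (by linarith)
  · exact three_cubes h12 h13 h23 h5 hprod hsum

theorem no_sol (m : ℕ) : ∀ X Y Z : ℤ, Z.natAbs = m → IsCoprime X Y →
    X ^ 3 + Y ^ 3 + 2 * Z ^ 3 = 2 * X * Y * Z → Z = 0 := by
  induction m using Nat.strong_induction_on with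
  | _ m ih =>
    intro X Y Z hm hc h
    by_contra hZ
    obtain ⟨A, B, C, h1, h2, h3, h4⟩ := descent_step hc hZ h
    exact h3 (ih _ (hm ▸ h4) A B C rfl h1 h2)

/-- The integral form of the statement. -/
theorem int_form {p q r : ℤ} (hc : IsCoprime p q) (hq : q ≠ 0)
    (h : r ^ 2 = p ^ 6 - 2 * p ^ 4 * q ^ 2 + 3 * p ^ 2 * q ^ 4 - q ^ 6) : p ^ 2 = q ^ 2 := by
  have hf : (r + p ^ 2 * q) * (r - p ^ 2 * q) = (p ^ 2 - q ^ 2) ^ 3 := by linear_combination h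
  have h3odd : Odd 3 := by decide
  -- a common prime of the two factors is 2
  have hcom : ∀ l : ℤ, Prime l → l ∣ r + p ^ 2 * q → l ∣ r - p ^ 2 * q → l ∣ 2 := by
    intro l hl h1 h2
    have h3 : l ∣ 2 * (p ^ 2 * q) := by
      have e : 2 * (p ^ 2 * q) = (r + p ^ 2 * q) - (r - p ^ 2 * q) := by ring
      rw [e]; exact dvd_sub h1 h2
    have h4 : l ∣ p ^ 2 - q ^ 2 := by
      apply hl.dvd_of_dvd_pow (n := 3)
      rw [← hf]; exact Dvd.dvd.mul_right h1 _
    rcases hl.dvd_or_dvd h3 with h5 | h5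
    · exact h5
    · exfalso
      rcases hl.dvd_or_dvd h5 with h6 | h6
      · have h8 := (dvd_sub_right h6).1 h4
        exact prime_no hl hc (hl.dvd_of_dvd_pow h6) (hl.dvd_of_dvd_pow h8)
      · have h8 := (dvd_sub_left (Dvd.dvd.pow h6 two_ne_zero)).1 h4
        exact prime_no hl hc (hl.dvd_of_dvd_pow h8) h6
  by_cases h2 : (2 : ℤ) ∣ r + p ^ 2 * q
  · have hr2 : (2 : ℤ) ∣ r - p ^ 2 * q := by omega
    have hm : (2 : ℤ) ∣ p ^ 2 - q ^ 2 := by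
      apply Int.prime_two.dvd_of_dvd_pow (n := 3)
      rw [← hf]; exact Dvd.dvd.mul_right h2 _
    have hodd : ¬ (2 : ℤ) ∣ p ^ 2 * q := by
      intro h3
      rcases Int.prime_two.dvd_or_dvd h3 with h6 | h6
      · have h8 := (dvd_sub_right h6).1 hm
        exact prime_no Int.prime_two hc (Int.prime_two.dvd_of_dvd_pow h6)
          (Int.prime_two.dvd_of_dvd_pow h8)
      · have h8 := (dvd_sub_left (Dvd.dvd.pow h6 two_ne_zero)).1 hm
        exact prime_no Int.prime_two hc (Int.prime_two.dvd_of_dvd_pow h8) h6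
    obtain ⟨u, hu⟩ := h2
    obtain ⟨v, hv⟩ := hr2
    obtain ⟨m, hm⟩ := hm
    have huv : u - v = p ^ 2 * q := by linarith
    have huvm : u * v = 2 * m ^ 3 := by
      rw [hu, hv, hm] at hf; linarith
    have hcop : IsCoprime u v := by
      apply cop_of_prime
      intro l hl h3 h4
      have h5 : l ∣ 2 := hcom l hl (hu ▸ Dvd.dvd.mul_left h3 _) (hv ▸ Dvd.dvd.mul_left h4 _)
      have h6 := prime_eq_of_dvd hl Int.prime_two h5
      exact hodd (huv ▸ dvd_sub (h6.trans h3) (h6.trans h4))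
    have hcq : ∀ A B : ℤ, A * B = m → IsCoprime A q := by
      intro A B hAB
      apply cop_of_prime
      intro l hl h3 h4
      have h5 : l ∣ p ^ 2 - q ^ 2 := by
        rw [hm, ← hAB]; exact Dvd.dvd.mul_left (Dvd.dvd.mul_right h3 _) _
      have h8 := (dvd_sub_left (Dvd.dvd.pow h4 two_ne_zero)).1 h5
      exact prime_no hl hc (hl.dvd_of_dvd_pow h8) h4
    rcases Int.prime_two.dvd_or_dvd (⟨m ^ 3, huvm⟩ : (2 : ℤ) ∣ u * v) with h3 | h3
    · obtain ⟨w, rfl⟩ := h3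
      have hwv : w * v = m ^ 3 := by linarith
      obtain ⟨⟨A, hA⟩, ⟨B, hB⟩⟩ :=
        Int.eq_pow_of_mul_eq_pow_odd hcop.of_mul_left_right h3odd hwv
      have hAB : B * A = m := by apply pow3_inj; rw [← hwv, hA, hB]; ring
      have hA0 := no_sol _ B q (-A) rfl (hcq B A hAB) (by
        rw [hA, hB] at huv
        linear_combination -q * hm - huv + 2 * q * hAB)
      rw [neg_eq_zero.1 hA0] at hAB
      rw [← hAB] at hm
      linarith
    · obtain ⟨w, rfl⟩ := h3
      have hwv : u * w = m ^ 3 := by linarith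
      obtain ⟨⟨A, hA⟩, ⟨B, hB⟩⟩ :=
        Int.eq_pow_of_mul_eq_pow_odd hcop.of_mul_right_right h3odd hwv
      have hAB : A * B = m := by apply pow3_inj; rw [← hwv, hA, hB]; ring
      have hA0 := no_sol _ A (-q) (-B) rfl (hcq A B hAB).neg_right (by
        rw [hA, hB] at huv
        linear_combination q * hm + huv - 2 * q * hAB)
      rw [neg_eq_zero.1 hA0] at hAB
      rw [← hAB] at hm
      linarith
  · have hcop : IsCoprime (r + p ^ 2 * q) (r - p ^ 2 * q) := by
      apply cop_of_prime
      intro l hl h3 h4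
      exact h2 ((prime_eq_of_dvd hl Int.prime_two (hcom l hl h3 h4)).trans h3)
    obtain ⟨⟨A, hA⟩, ⟨B, hB⟩⟩ := Int.eq_pow_of_mul_eq_pow_odd hcop h3odd hf
    have hAB : A * B = p ^ 2 - q ^ 2 := by
      apply pow3_inj; rw [← hf, hA, hB]; ring
    have hABc : IsCoprime A (-B) := by
      rw [hA, hB] at hcop
      exact ((IsCoprime.pow_iff (by norm_num) (by norm_num)).1 hcop).neg_right
    have := no_sol _ A (-B) (-q) rfl hABc (by linear_combination hB - hA - 2 * q * hAB)
    exact absurd (neg_eq_zero.1 this) hq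

theorem stmt_15 (x y : ℚ) :
    y ^ 2 = x ^ 6 - 2 * x ^ 4 + 3 * x ^ 2 - 1 ↔ (x = 1 ∨ x = -1) ∧ (y = 1 ∨ y = -1) := by
  constructor
  · intro h
    have hq0 : (x.den : ℤ) ≠ 0 := by exact_mod_cast x.den_ne_zero
    have hq0' : (x.den : ℚ) ≠ 0 := by exact_mod_cast x.den_ne_zero
    have hx : x * x.den = x.num := Rat.mul_den_eq_num x
    have hsq : (y * x.den ^ 3) ^ 2 = ((x.num ^ 6 - 2 * x.num ^ 4 * (x.den : ℤ) ^ 2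
        + 3 * x.num ^ 2 * (x.den : ℤ) ^ 4 - (x.den : ℤ) ^ 6 : ℤ) : ℚ) := by
      push_cast
      rw [← hx]
      linear_combination (x.den : ℚ) ^ 6 * h
    obtain ⟨r, hr⟩ : ∃ r : ℤ, (r : ℚ) = y * x.den ^ 3 := by
      have hint : IsIntegral ℤ (y * x.den ^ 3) := by
        apply IsIntegral.of_pow (n := 2) (by norm_num)
        rw [hsq]
        exact isIntegral_algebraMap (R := ℤ) (A := ℚ)
      obtain ⟨r, hr⟩ := IsIntegrallyClosed.isIntegral_iff.1 hint
      exact ⟨r, hr⟩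
    rw [← hr] at hsq
    have hint : r ^ 2 = x.num ^ 6 - 2 * x.num ^ 4 * (x.den : ℤ) ^ 2
        + 3 * x.num ^ 2 * (x.den : ℤ) ^ 4 - (x.den : ℤ) ^ 6 := by exact_mod_cast hsq
    have hc : IsCoprime x.num (x.den : ℤ) := Int.isCoprime_iff_nat_coprime.2 (by
      simpa using x.reduced)
    have key := int_form hc hq0 hint
    have key' : (x.num : ℚ) ^ 2 = (x.den : ℚ) ^ 2 := by exact_mod_cast key
    have hx2 : x ^ 2 = 1 := by
      apply mul_right_cancel₀ (pow_ne_zero 2 hq0')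
      rw [← mul_pow, hx, key', one_mul]
    have hy2 : y ^ 2 = 1 := by
      rw [h]
      linear_combination (x ^ 4 - x ^ 2 + 2) * hx2
    exact ⟨by simpa using hx2, by simpa using hy2⟩
  · rintro ⟨rfl | rfl, rfl | rfl⟩ <;> norm_num
end

section
/- For c = 3 and f(x) = x^2 + 3, the Galois group of the splitting field of the third iterate f^3(x) = ((x^2+3)^2+3)^2+3 over ℚ has order 64, which is strictly less than 128 = 2^{2^3 - 1}. -/
open Polynomial

/-- The third iterate of `x ↦ x² + 3`, namely `((x² + 3)² + 3)² + 3`, as a polynomial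
over `ℚ`. -/
noncomputable def fIter3 : Polynomial ℚ := ((X ^ 2 + 3) ^ 2 + 3) ^ 2 + 3

open IntermediateField

/-- The field `K(r)`, as an intermediate field of `ℂ / ℚ`. -/
noncomputable def extF (K : IntermediateField ℚ ℂ) (r : ℂ) : IntermediateField ℚ ℂ :=
  (IntermediateField.adjoin K {r}).restrictScalars ℚ

lemma le_extF (K : IntermediateField ℚ ℂ) (r : ℂ) : K ≤ extF K r := by
  intro x hx
  exact (IntermediateField.adjoin K {r}).algebraMap_mem (⟨x, hx⟩ : K)

lemma self_mem_extF (K : IntermediateField ℚ ℂ) (r : ℂ) : r ∈ extF K r :=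
  IntermediateField.mem_adjoin_simple_self K r

lemma isIntegral_of_sq {K : IntermediateField ℚ ℂ} {r : ℂ} (h : r ^ 2 ∈ K) : IsIntegral K r := by
  refine ⟨X ^ 2 - C (⟨r ^ 2, h⟩ : K), monic_X_pow_sub_C _ two_ne_zero, ?_⟩
  simp [eval₂_sub]

lemma mem_extF {K : IntermediateField ℚ ℂ} {r : ℂ} (h : r ^ 2 ∈ K) {x : ℂ} (hx : x ∈ extF K r) :
    ∃ u : ℂ, u ∈ K ∧ ∃ v : ℂ, v ∈ K ∧ x = u + v * r := by
  have hx' : x ∈ (IntermediateField.adjoin K {r}).toSubalgebra := hx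
  rw [IntermediateField.adjoin_simple_toSubalgebra_of_isAlgebraic
    (isIntegral_of_sq h).isAlgebraic] at hx'
  clear hx
  induction hx' using Algebra.adjoin_induction with
  | mem x hx =>
    rw [Set.mem_singleton_iff] at hx
    exact ⟨0, K.zero_mem, 1, K.one_mem, by rw [hx]; ring⟩
  | algebraMap k => exact ⟨k, k.2, 0, K.zero_mem, by simp⟩
  | add x y hx hy ihx ihy =>
    obtain ⟨u, hu, v, hv, rfl⟩ := ihx
    obtain ⟨u', hu', v', hv', rfl⟩ := ihy
    exact ⟨u + u', K.add_mem hu hu', v + v', K.add_mem hv hv', by ring⟩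
  | mul x y hx hy ihx ihy =>
    obtain ⟨u, hu, v, hv, rfl⟩ := ihx
    obtain ⟨u', hu', v', hv', rfl⟩ := ihy
    exact ⟨u * u' + v * v' * r ^ 2, K.add_mem (K.mul_mem hu hu')
      (K.mul_mem (K.mul_mem hv hv') h), u * v' + v * u',
      K.add_mem (K.mul_mem hu hv') (K.mul_mem hv hu'), by ring⟩

lemma extF_le {K M : IntermediateField ℚ ℂ} {r : ℂ} (h : r ^ 2 ∈ K) (hK : K ≤ M) (hr : r ∈ M) :
    extF K r ≤ M := by
  intro x hx
  obtain ⟨u, hu, v, hv, rfl⟩ := mem_extF h hx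
  exact M.add_mem (hK hu) (M.mul_mem (hK hv) hr)

lemma extF_comm {K : IntermediateField ℚ ℂ} {r t : ℂ} (hr : r ^ 2 ∈ K) (ht : t ^ 2 ∈ K) :
    extF (extF K r) t = extF (extF K t) r := by
  apply le_antisymm
  · exact extF_le (le_extF _ _ ht) (extF_le hr ((le_extF _ _).trans (le_extF _ _))
      (self_mem_extF _ _)) (le_extF _ _ (self_mem_extF _ _))
  · exact extF_le (le_extF _ _ hr) (extF_le ht ((le_extF _ _).trans (le_extF _ _))
      (self_mem_extF _ _)) (le_extF _ _ (self_mem_extF _ _))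

lemma finrank_extF {K : IntermediateField ℚ ℂ} {r : ℂ} (h : r ^ 2 ∈ K) (hr : r ∉ K) :
    Module.finrank ℚ (extF K r) = 2 * Module.finrank ℚ K := by
  have h2 : Module.finrank K (IntermediateField.adjoin K {r}) = 2 := by
    rw [IntermediateField.adjoin.finrank (isIntegral_of_sq h)]
    apply le_antisymm
    · have hd : minpoly K r ∣ X ^ 2 - C (⟨r ^ 2, h⟩ : K) := by
        apply minpoly.dvd
        simp
      calc _ ≤ _ := natDegree_le_of_dvd hd (monic_X_pow_sub_C _ two_ne_zero).ne_zero
        _ = 2 := natDegree_X_pow_sub_C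
    · rw [minpoly.two_le_natDegree_iff (isIntegral_of_sq h)]
      rintro ⟨k, rfl⟩
      exact hr k.2
  have := Module.finrank_mul_finrank ℚ K (IntermediateField.adjoin K {r})
  rw [h2, mul_comm] at this
  exact this.symm

lemma coord_zero {K : IntermediateField ℚ ℂ} {r x y : ℂ} (hr : r ∉ K) (hx : x ∈ K) (hy : y ∈ K)
    (h : x + y * r = 0) : y = 0 ∧ x = 0 := by
  have hy0 : y = 0 := by
    by_contra hne
    apply hr
    have : r = -x / y := by field_simp; linear_combination h
    rw [this]
    exact K.div_mem (K.neg_mem hx) hy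
  subst hy0
  exact ⟨rfl, by simpa using h⟩

lemma sq_coords {K : IntermediateField ℚ ℂ} {r x y z : ℂ} (h : r ^ 2 ∈ K) (hr : r ∉ K)
    (hx : x ∈ K) (hy : y ∈ K) (hz : z ∈ extF K r) (hzz : z ^ 2 = x + y * r) :
    ∃ u : ℂ, u ∈ K ∧ ∃ v : ℂ, v ∈ K ∧ z = u + v * r ∧ x = u ^ 2 + v ^ 2 * r ^ 2 ∧ y = 2 * u * v := by
  obtain ⟨u, hu, v, hv, rfl⟩ := mem_extF h hz
  have h2 : (2 : ℂ) ∈ K := ofNat_mem K 2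
  have := coord_zero (x := u ^ 2 + v ^ 2 * r ^ 2 - x) (y := 2 * u * v - y) hr
    (K.sub_mem (K.add_mem (pow_mem hu 2) (K.mul_mem (pow_mem hv 2) h)) hx)
    (K.sub_mem (K.mul_mem (K.mul_mem h2 hu) hv) hy) (by linear_combination hzz)
  exact ⟨u, hu, v, hv, rfl, by linear_combination -this.2, by linear_combination -this.1⟩

lemma norm_sq {K : IntermediateField ℚ ℂ} {r x y z : ℂ} (h : r ^ 2 ∈ K) (hr : r ∉ K)
    (hx : x ∈ K) (hy : y ∈ K) (hz : z ∈ extF K r) (hzz : z ^ 2 = x + y * r) :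
    ∃ w : ℂ, w ∈ K ∧ w ^ 2 = x ^ 2 - r ^ 2 * y ^ 2 := by
  obtain ⟨u, hu, v, hv, -, rfl, rfl⟩ := sq_coords h hr hx hy hz hzz
  exact ⟨u ^ 2 - v ^ 2 * r ^ 2, K.sub_mem (pow_mem hu 2) (K.mul_mem (pow_mem hv 2) h), by ring⟩

lemma sq_descend {K : IntermediateField ℚ ℂ} {r z : ℂ} (h : r ^ 2 ∈ K) (hr : r ∉ K)
    (hz : z ∈ extF K r) (hzz : z ^ 2 ∈ K) : z ∈ K ∨ z * r ∈ K := by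
  obtain ⟨u, hu, v, hv, rfl, h1, h2⟩ := sq_coords h hr hzz K.zero_mem hz (by ring)
  have : u = 0 ∨ v = 0 := by
    have : u * v = 0 := by linear_combination -h2 / 2
    exact mul_eq_zero.mp this
  rcases this with rfl | rfl
  · right
    have : (0 + v * r) * r = v * r ^ 2 := by ring
    rw [this]; exact K.mul_mem hv h
  · left; simpa using hu

lemma sq_descend2 {K : IntermediateField ℚ ℂ} {r t z : ℂ} (h : r ^ 2 ∈ K) (ht : t ^ 2 ∈ K)
    (hr : r ∉ K) (htr : t ∉ extF K r)
    (hz : z ∈ extF (extF K r) t) (hzz : z ^ 2 ∈ K) :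
    z ∈ K ∨ z * r ∈ K ∨ z * t ∈ K ∨ z * t * r ∈ K := by
  rcases sq_descend (le_extF _ _ ht) htr hz (le_extF _ _ hzz) with h1 | h1
  · rcases sq_descend h hr h1 hzz with h2 | h2 <;> tauto
  · rcases sq_descend h hr h1 (by rw [mul_pow]; exact K.mul_mem hzz ht) with h2 | h2 <;> tauto

lemma mem_bot' {x : ℂ} (hx : x ∈ (⊥ : IntermediateField ℚ ℂ)) : ∃ q : ℚ, x = q := by
  obtain ⟨q, rfl⟩ := IntermediateField.mem_bot.mp hx
  exact ⟨q, by simp⟩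

lemma rat_mem (K : IntermediateField ℚ ℂ) (q : ℚ) : (q : ℂ) ∈ K := by
  simpa using K.algebraMap_mem q

lemma not_sq_of {n : ℕ} (h : ¬ IsSquare n) (w : ℚ) : w ^ 2 ≠ n := by
  intro hw
  apply h
  rw [← Rat.isSquare_natCast_iff]
  exact ⟨w, by rw [← hw]; ring⟩

section K1
variable {s : ℂ} (hs : s ^ 2 = -3)
include hs

lemma s_sq_mem (K : IntermediateField ℚ ℂ) : s ^ 2 ∈ K := by
  rw [hs]; simpa using rat_mem K (-3)

lemma s_not_mem : s ∉ (⊥ : IntermediateField ℚ ℂ) := by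
  intro h
  obtain ⟨q, rfl⟩ := mem_bot' h
  have : q ^ 2 = -3 := by exact_mod_cast hs
  nlinarith [sq_nonneg q]

/-- Squares in `ℚ(√-3)`. -/
lemma sq_K1 {z : ℂ} {x y : ℚ} (hz : z ∈ extF ⊥ s) (hzz : z ^ 2 = x + y * s) :
    ∃ u v : ℚ, x = u ^ 2 - 3 * v ^ 2 ∧ y = 2 * u * v := by
  obtain ⟨u, hu, v, hv, -, h1, h2⟩ := sq_coords (s_sq_mem hs _) (s_not_mem hs) (rat_mem _ x)
    (rat_mem _ y) hz hzz
  obtain ⟨u, rfl⟩ := mem_bot' hu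
  obtain ⟨v, rfl⟩ := mem_bot' hv
  rw [hs] at h1
  refine ⟨u, v, ?_, by exact_mod_cast h2⟩
  have : (x : ℂ) = ((u ^ 2 - 3 * v ^ 2 : ℚ) : ℂ) := by rw [h1]; push_cast; ring
  exact_mod_cast this

lemma norm_K1 {z : ℂ} {x y : ℚ} (hz : z ∈ extF ⊥ s) (hzz : z ^ 2 = x + y * s) :
    ∃ w : ℚ, w ^ 2 = x ^ 2 + 3 * y ^ 2 := by
  obtain ⟨u, v, rfl, rfl⟩ := sq_K1 hs hz hzz
  exact ⟨u ^ 2 + 3 * v ^ 2, by ring⟩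

end K1

/-- All the data: a full set of preimages of `0` under the iterates. -/
structure Dat (s a b p q r w : ℂ) : Prop where
  hs : s ^ 2 = -3
  ha : a ^ 2 = -3 + s
  hb : b ^ 2 = -3 - s
  hp : p ^ 2 = -3 + a
  hq : q ^ 2 = -3 - a
  hr : r ^ 2 = -3 + b
  hw : w ^ 2 = -3 - b

namespace Dat
variable {s a b p q r w : ℂ} (D : Dat s a b p q r w)
include D

lemma s_mem : s ∈ extF ⊥ s := self_mem_extF _ _

lemma a2_mem : a ^ 2 ∈ extF ⊥ s := by
  rw [D.ha]; exact add_mem (by simpa using rat_mem _ (-3)) (self_mem_extF _ _)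

lemma b2_mem : b ^ 2 ∈ extF ⊥ s := by
  rw [D.hb]; exact sub_mem (by simpa using rat_mem _ (-3)) (self_mem_extF _ _)

lemma a_not : a ∉ extF ⊥ s := by
  intro h
  obtain ⟨w, hw⟩ := norm_K1 (x := -3) (y := 1) D.hs h (by rw [D.ha]; push_cast; ring)
  exact not_sq_of (n := 12) (by norm_num) w (by rw [hw]; norm_num)

lemma b_not : b ∉ extF ⊥ s := by
  intro h
  obtain ⟨w, hw⟩ := norm_K1 (x := -3) (y := -1) D.hs h (by rw [D.hb]; push_cast; ring)
  exact not_sq_of (n := 12) (by norm_num) w (by rw [hw]; norm_num)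

lemma ab2 : (a * b) ^ 2 = 12 := by
  rw [mul_pow, D.ha, D.hb]; linear_combination -D.hs

lemma ab_not : a * b ∉ extF ⊥ s := by
  intro h
  obtain ⟨u, v, h1, h2⟩ := sq_K1 (x := 12) (y := 0) D.hs h (by rw [D.ab2]; push_cast; ring)
  have : u = 0 ∨ v = 0 := by
    have : u * v = 0 := by linear_combination -h2 / 2
    exact mul_eq_zero.mp this
  rcases this with rfl | rfl
  · nlinarith [sq_nonneg v]
  · exact not_sq_of (n := 12) (by norm_num) u (by push_cast; linarith)

lemma b_not' : b ∉ extF (extF ⊥ s) a := by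
  intro h
  rcases sq_descend D.a2_mem D.a_not h D.b2_mem with h1 | h1
  · exact D.b_not h1
  · exact D.ab_not (by rwa [mul_comm])

lemma a_not' : a ∉ extF (extF ⊥ s) b := by
  intro h
  rcases sq_descend D.b2_mem D.b_not h D.a2_mem with h1 | h1
  · exact D.a_not h1
  · exact D.ab_not h1

lemma K2_comm : extF (extF (extF ⊥ s) a) b = extF (extF (extF ⊥ s) b) a :=
  extF_comm D.a2_mem D.b2_mem

lemma s_ne (x : ℚ) : (x : ℂ) + s ≠ 0 := by
  intro h
  apply s_not_mem D.hs
  have : s = ((-x : ℚ) : ℂ) := by push_cast; linear_combination h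
  rw [this]; exact rat_mem _ _

lemma H1 {z : ℂ} (hz : z ∈ extF (extF (extF ⊥ s) a) b) : z ^ 2 ≠ 12 - s := by
  intro hzz
  have hm : z ^ 2 ∈ extF ⊥ s := by
    rw [hzz]; exact sub_mem (by simpa using rat_mem _ 12) (self_mem_extF _ _)
  have hs := D.hs
  rcases sq_descend2 D.a2_mem D.b2_mem D.a_not D.b_not' hz hm with h | h | h | h
  · obtain ⟨w, hw⟩ := norm_K1 (x := 12) (y := -1) hs h (by rw [hzz]; push_cast; ring)
    exact not_sq_of (n := 147) (by norm_num) w (by rw [hw]; norm_num)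
  · obtain ⟨u, v, h1, h2⟩ := sq_K1 (x := -33) (y := 15) hs h (by
      rw [mul_pow, hzz, D.ha]; push_cast; linear_combination -hs)
    have h3 : (u ^ 2 + 3 * v ^ 2) ^ 2 = 42 ^ 2 := by
      have : (u ^ 2 + 3 * v ^ 2) ^ 2 = (u ^ 2 - 3 * v ^ 2) ^ 2 + 3 * (2 * u * v) ^ 2 := by ring
      rw [this, ← h1, ← h2]; norm_num
    have h4 : u ^ 2 + 3 * v ^ 2 = 42 :=
      (pow_left_inj₀ (by positivity) (by norm_num) two_ne_zero).mp h3
    exact not_sq_of (n := 18) (by norm_num) (2 * u) (by push_cast; linarith)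
  · obtain ⟨u, v, h1, h2⟩ := sq_K1 (x := -39) (y := -9) hs h (by
      rw [mul_pow, hzz, D.hb]; push_cast; linear_combination hs)
    have h3 : (u ^ 2 + 3 * v ^ 2) ^ 2 = 42 ^ 2 := by
      have : (u ^ 2 + 3 * v ^ 2) ^ 2 = (u ^ 2 - 3 * v ^ 2) ^ 2 + 3 * (2 * u * v) ^ 2 := by ring
      rw [this, ← h1, ← h2]; norm_num
    have h4 : u ^ 2 + 3 * v ^ 2 = 42 :=
      (pow_left_inj₀ (by positivity) (by norm_num) two_ne_zero).mp h3
    exact not_sq_of (n := 6) (by norm_num) (2 * u) (by push_cast; linarith)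
  · obtain ⟨w, hw⟩ := norm_K1 (x := 144) (y := -12) hs h (by
      have : (z * b * a) ^ 2 = z ^ 2 * (a * b) ^ 2 := by ring
      rw [this, hzz, D.ab2]; push_cast; ring)
    exact not_sq_of (n := 21168) (by norm_num) w (by rw [hw]; norm_num)

lemma a_mem2 : a ∈ extF (extF (extF ⊥ s) a) b := le_extF _ _ (self_mem_extF _ _)
lemma b_mem2 : b ∈ extF (extF (extF ⊥ s) a) b := self_mem_extF _ _
lemma s_mem2 : s ∈ extF (extF (extF ⊥ s) a) b := le_extF _ _ (le_extF _ _ (self_mem_extF _ _))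

lemma H2 {z : ℂ} (hz : z ∈ extF (extF (extF ⊥ s) a) b) : z ^ 2 ≠ 12 + s := by
  intro hzz
  have h0 : (12 : ℂ) + s ≠ 0 := by simpa using D.s_ne 12
  apply D.H1 (z := ((7 / 2 : ℚ) : ℂ) * (a * b) / z)
    (div_mem (mul_mem (rat_mem _ _) (mul_mem D.a_mem2 D.b_mem2)) hz)
  rw [div_pow, mul_pow, D.ab2, hzz, div_eq_iff h0]
  push_cast
  linear_combination D.hs

lemma K1b_le : extF (extF ⊥ s) b ≤ extF (extF (extF ⊥ s) a) b := by
  rw [D.K2_comm]; exact le_extF _ _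

lemma K1a_le : extF (extF ⊥ s) a ≤ extF (extF (extF ⊥ s) a) b := le_extF _ _

/-- norm down to `K1(b)` -/
lemma NA {c z : ℂ} {e : ℚ} (he : e ^ 2 = 1) (hc : c ∈ extF (extF ⊥ s) b) (hc0 : c ≠ 0)
    (hz : z ∈ extF (extF (extF ⊥ s) a) b) : z ^ 2 ≠ c * (-3 + e * a) := by
  intro hzz
  rw [D.K2_comm] at hz
  obtain ⟨w, hw, hww⟩ := norm_sq (x := c * ((-3 : ℚ) : ℂ)) (y := c * (e : ℂ))
    (le_extF _ _ D.a2_mem) D.a_not'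
    (mul_mem hc (rat_mem _ _)) (mul_mem hc (rat_mem _ _)) hz (by rw [hzz]; push_cast; ring)
  apply D.H1 (D.K1b_le (div_mem hw hc))
  have he' : (e : ℂ) ^ 2 = 1 := by exact_mod_cast he
  rw [div_pow, hww, div_eq_iff (pow_ne_zero 2 hc0), D.ha, mul_pow, mul_pow, he']
  push_cast; ring

/-- norm down to `K1(a)` -/
lemma NB {c z : ℂ} (hc : c ∈ extF (extF ⊥ s) a) (hc0 : c ≠ 0)
    (hz : z ∈ extF (extF (extF ⊥ s) a) b) : z ^ 2 ≠ c * (-3 + b) := by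
  intro hzz
  obtain ⟨w, hw, hww⟩ := norm_sq (x := c * ((-3 : ℚ) : ℂ)) (y := c)
    (le_extF _ _ D.b2_mem) D.b_not'
    (mul_mem hc (rat_mem _ _)) hc hz (by rw [hzz]; push_cast; ring)
  apply D.H2 (D.K1a_le (div_mem hw hc))
  rw [div_pow, hww, div_eq_iff (pow_ne_zero 2 hc0), D.hb, mul_pow]
  push_cast; ring

lemma p2_mem : p ^ 2 ∈ extF (extF (extF ⊥ s) a) b := by
  rw [D.hp]; exact add_mem (by simpa using rat_mem _ (-3)) D.a_mem2
lemma q2_mem : q ^ 2 ∈ extF (extF (extF ⊥ s) a) b := by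
  rw [D.hq]; exact sub_mem (by simpa using rat_mem _ (-3)) D.a_mem2
lemma r2_mem : r ^ 2 ∈ extF (extF (extF ⊥ s) a) b := by
  rw [D.hr]; exact add_mem (by simpa using rat_mem _ (-3)) D.b_mem2

lemma pq2 : (p * q) ^ 2 = 12 - s := by
  rw [mul_pow, D.hp, D.hq]; linear_combination -D.ha

lemma p_not : p ∉ extF (extF (extF ⊥ s) a) b := fun h =>
  D.NA (c := 1) (e := 1) (by norm_num) (one_mem _) one_ne_zero h (by rw [D.hp]; push_cast; ring)

lemma q_not : q ∉ extF (extF (extF ⊥ s) a) b := fun h =>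
  D.NA (c := 1) (e := -1) (by norm_num) (one_mem _) one_ne_zero h (by rw [D.hq]; push_cast; ring)

lemma q_not' : q ∉ extF (extF (extF (extF ⊥ s) a) b) p := by
  intro h
  rcases sq_descend D.p2_mem D.p_not h D.q2_mem with h1 | h1
  · exact D.q_not h1
  · exact D.H1 h1 (by rw [mul_comm, D.pq2])

lemma b_ne : -3 + b ≠ 0 := by
  intro h
  apply D.b_not
  have : b = ((3 : ℚ) : ℂ) := by push_cast; linear_combination h
  rw [this]; exact rat_mem _ _

lemma s12_ne : (12 : ℂ) - s ≠ 0 := by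
  intro h
  apply D.s_ne (-12)
  push_cast; linear_combination -h

lemma r_not : r ∉ extF (extF (extF (extF (extF ⊥ s) a) b) p) q := by
  intro h
  have hbm : -3 + b ∈ extF (extF ⊥ s) b :=
    add_mem (by simpa using rat_mem _ (-3)) (self_mem_extF _ _)
  rcases sq_descend2 D.p2_mem D.q2_mem D.p_not D.q_not' h D.r2_mem with h | h | h | h
  · exact D.NB (c := 1) (one_mem _) one_ne_zero h (by rw [D.hr]; ring)
  · exact D.NA (e := 1) (by norm_num) hbm D.b_ne h
      (by rw [mul_pow, D.hr, D.hp]; push_cast; ring)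
  · exact D.NA (e := -1) (by norm_num) hbm D.b_ne h
      (by rw [mul_pow, D.hr, D.hq]; push_cast; ring)
  · refine D.NB (c := 12 - s) (le_extF _ _ (sub_mem (by simpa using rat_mem _ 12)
      (self_mem_extF _ _))) D.s12_ne h ?_
    rw [← D.pq2, ← D.hr]; ring

lemma finrank_K6 :
    Module.finrank ℚ (extF (extF (extF (extF (extF (extF ⊥ s) a) b) p) q) r) = 64 := by
  rw [finrank_extF (le_extF _ _ (le_extF _ _ D.r2_mem)) D.r_not,
    finrank_extF (le_extF _ _ D.q2_mem) D.q_not', finrank_extF D.p2_mem D.p_not,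
    finrank_extF (le_extF _ _ D.b2_mem) D.b_not', finrank_extF D.a2_mem D.a_not,
    finrank_extF (s_sq_mem D.hs _) (s_not_mem D.hs), IntermediateField.finrank_bot]

lemma w_mem : w ∈ extF (extF (extF (extF (extF (extF ⊥ s) a) b) p) q) r := by
  have h : (w * (p * q * r)) ^ 2 = (7 / 2 * (a * b)) ^ 2 := by
    have : (w * (p * q * r)) ^ 2 = (p * q) ^ 2 * (r ^ 2 * w ^ 2) := by ring
    rw [this, D.pq2, D.hr, D.hw, mul_pow, D.ab2]
    linear_combination (-1) * D.hs - (12 - s) * D.hb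
  have hr0 : r ≠ 0 := fun h0 => D.r_not (h0 ▸ zero_mem _)
  have hp0 : p ≠ 0 := fun h0 => D.p_not (h0 ▸ zero_mem _)
  have hq0 : q ≠ 0 := fun h0 => D.q_not (h0 ▸ zero_mem _)
  set K := extF (extF (extF (extF (extF (extF ⊥ s) a) b) p) q) r
  have hab : (7 / 2 * (a * b)) ∈ K := by
    refine mul_mem (by simpa using rat_mem K (7 / 2)) ?_
    exact le_extF _ _ (le_extF _ _ (le_extF _ _ (mul_mem D.a_mem2 D.b_mem2)))
  have hpqr : p * q * r ∈ K := mul_mem (mul_mem (le_extF _ _ (le_extF _ _ (self_mem_extF _ _)))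
    (le_extF _ _ (self_mem_extF _ _))) (self_mem_extF _ _)
  have hne : p * q * r ≠ 0 := by simp [hr0, hp0, hq0]
  rw [eq_div_of_mul_eq hne (rfl : w * (p * q * r) = _)]
  refine div_mem ?_ hpqr
  rcases sq_eq_sq_iff_eq_or_eq_neg.mp h with h | h
  · rw [h]; exact hab
  · rw [h]; exact neg_mem hab

lemma fne : fIter3 ≠ 0 := by
  intro h
  have := congrArg (Polynomial.eval 0) h
  norm_num [fIter3] at this

lemma mem_roots_iff (x : ℂ) : x ∈ fIter3.rootSet ℂ ↔ ((x ^ 2 + 3) ^ 2 + 3) ^ 2 + 3 = 0 := by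
  rw [mem_rootSet, and_iff_right D.fne]
  have h3 : (aeval x) (3 : ℚ[X]) = 3 := map_ofNat _ 3
  simp [fIter3, h3]

lemma adjoin_eq : IntermediateField.adjoin ℚ (fIter3.rootSet ℂ) =
    extF (extF (extF (extF (extF (extF ⊥ s) a) b) p) q) r := by
  apply le_antisymm
  · rw [IntermediateField.adjoin_le_iff]
    intro x hx
    rw [D.mem_roots_iff] at hx
    have hp : p ∈ extF (extF (extF (extF (extF (extF ⊥ s) a) b) p) q) r :=
      le_extF _ _ (le_extF _ _ (self_mem_extF _ _))
    have hq : q ∈ extF (extF (extF (extF (extF (extF ⊥ s) a) b) p) q) r :=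
      le_extF _ _ (self_mem_extF _ _)
    have hr := self_mem_extF (extF (extF (extF (extF (extF ⊥ s) a) b) p) q) r
    have key : ∀ t, t ∈ extF (extF (extF (extF (extF (extF ⊥ s) a) b) p) q) r → x ^ 2 = t ^ 2 →
        x ∈ extF (extF (extF (extF (extF (extF ⊥ s) a) b) p) q) r := by
      intro t ht h
      rcases sq_eq_sq_iff_eq_or_eq_neg.mp h with h | h
      · rw [h]; exact ht
      · rw [h]; exact neg_mem ht
    have h1 : ((x ^ 2 + 3) ^ 2 + 3) ^ 2 = s ^ 2 := by rw [D.hs]; linear_combination hx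
    rcases sq_eq_sq_iff_eq_or_eq_neg.mp h1 with h1 | h1
    · have h2 : (x ^ 2 + 3) ^ 2 = a ^ 2 := by rw [D.ha]; linear_combination h1
      rcases sq_eq_sq_iff_eq_or_eq_neg.mp h2 with h2 | h2
      · exact key p hp (by rw [D.hp]; linear_combination h2)
      · exact key q hq (by rw [D.hq]; linear_combination h2)
    · have h2 : (x ^ 2 + 3) ^ 2 = b ^ 2 := by rw [D.hb]; linear_combination h1
      rcases sq_eq_sq_iff_eq_or_eq_neg.mp h2 with h2 | h2
      · exact key r hr (by rw [D.hr]; linear_combination h2)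
      · exact key w D.w_mem (by rw [D.hw]; linear_combination h2)
  · have hs := D.hs
    have ha := D.ha
    have hb := D.hb
    set M := IntermediateField.adjoin ℚ (fIter3.rootSet ℂ)
    have three : (3 : ℂ) ∈ M := ofNat_mem M 3
    have hp : p ∈ M := by
      apply IntermediateField.subset_adjoin
      rw [D.mem_roots_iff, D.hp]
      have : (-3 + a + 3) ^ 2 + 3 = s := by linear_combination ha
      rw [this, hs]; ring
    have hq : q ∈ M := by
      apply IntermediateField.subset_adjoin
      rw [D.mem_roots_iff, D.hq]
      have : (-3 - a + 3) ^ 2 + 3 = s := by linear_combination ha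
      rw [this, hs]; ring
    have hr : r ∈ M := by
      apply IntermediateField.subset_adjoin
      rw [D.mem_roots_iff, D.hr]
      have : (-3 + b + 3) ^ 2 + 3 = -s := by linear_combination hb
      rw [this, neg_sq, hs]; ring
    have ha' : a ∈ M := by
      have : a = p ^ 2 + 3 := by linear_combination -D.hp
      rw [this]; exact add_mem (pow_mem hp 2) three
    have hb' : b ∈ M := by
      have : b = r ^ 2 + 3 := by linear_combination -D.hr
      rw [this]; exact add_mem (pow_mem hr 2) three
    have hs' : s ∈ M := by
      have : s = a ^ 2 + 3 := by linear_combination -D.ha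
      rw [this]; exact add_mem (pow_mem ha' 2) three
    exact extF_le (le_extF _ _ (le_extF _ _ D.r2_mem)) (extF_le (le_extF _ _ D.q2_mem)
      (extF_le D.p2_mem (extF_le (le_extF _ _ D.b2_mem) (extF_le D.a2_mem
      (extF_le (s_sq_mem hs _) bot_le hs') ha') hb') hp) hq) hr

end Dat

lemma exists_dat : ∃ s a b p q r w : ℂ, Dat s a b p q r w := by
  have sq (x : ℂ) : ∃ y : ℂ, y ^ 2 = x := IsAlgClosed.exists_pow_nat_eq x two_pos
  obtain ⟨s, hs⟩ := sq (-3)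
  obtain ⟨a, ha⟩ := sq (-3 + s)
  obtain ⟨b, hb⟩ := sq (-3 - s)
  obtain ⟨p, hp⟩ := sq (-3 + a)
  obtain ⟨q, hq⟩ := sq (-3 - a)
  obtain ⟨r, hr⟩ := sq (-3 + b)
  obtain ⟨w, hw⟩ := sq (-3 - b)
  exact ⟨s, a, b, p, q, r, w, hs, ha, hb, hp, hq, hr, hw⟩

lemma finrank_splitting {F L : Type*} [Field F] [Field L] [Algebra F L] {f : F[X]}
    (h : (f.map (algebraMap F L)).Splits) :
    Module.finrank F (IntermediateField.adjoin F (f.rootSet L)) =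
      Module.finrank F f.SplittingField := by
  have := IntermediateField.adjoin_rootSet_isSplittingField h
  exact (IsSplittingField.algEquiv
    (IntermediateField.adjoin F (f.rootSet L)) f).toLinearEquiv.finrank_eq

lemma card_gal_eq {F : Type*} [Field F] [CharZero F] (f : F[X]) :
    Nat.card f.Gal = Module.finrank F f.SplittingField := by
  have : IsGalois F f.SplittingField := {}
  exact IsGalois.card_aut_eq_finrank F f.SplittingField

theorem stmt_19 : Nat.card fIter3.Gal = 64 ∧ 64 < 2 ^ (2 ^ 3 - 1) := by
  refine ⟨?_, by norm_num⟩
  obtain ⟨s, a, b, p, q, r, w, D⟩ := exists_dat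
  have hsp : (fIter3.map (algebraMap ℚ ℂ)).Splits := IsAlgClosed.splits _
  rw [card_gal_eq, ← finrank_splitting hsp, D.adjoin_eq]
  exact D.finrank_K6
end
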